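/- arXiv:1905.02873 — 2 statements merged into one kernel-verified Lean document; each statement's English description precedes it below -/
import Mathlib

section
/- Let \(\mathcal{L}\) be a family of Borel measures on \(X\) with \(\mathrm{Mod}_p(\mathcal{L})<\infty\). Then there exists a \(p\)-weakly admissible nonnegative Borel function \(\rho\) for \(\mathcal{L}\) such that \(\int_X\rho^p\,d\mu=\mathrm{Mod}_p(\mathcal{L})\); that is, the modulus is attained by a weakly admissible function. -/
open MeasureTheory Metric Set ENNReal NNReal Filter Topology

noncomputable section

/-- A rectifiable curve, parametrized by arclength (hence `1`-Lipschitz) on `[0, len]`. -/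
structure Curve (X : Type*) [MetricSpace X] where
  len : ℝ
  len_nonneg : 0 ≤ len
  toFun : ℝ → X
  lip : LipschitzOnWith 1 toFun (Set.Icc 0 len)

variable {X : Type*} [MetricSpace X] [MeasurableSpace X]

namespace Curve

/-- The image of a curve. -/
def image (γ : Curve X) : Set X := γ.toFun '' Set.Icc 0 γ.len

/-- A curve is nonconstant if it takes at least two values. -/
def Nonconstant (γ : Curve X) : Prop :=
  ∃ s ∈ Set.Icc (0:ℝ) γ.len, ∃ t ∈ Set.Icc (0:ℝ) γ.len, γ.toFun s ≠ γ.toFun t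

/-- A curve lies in a set `A`. -/
def IsIn (γ : Curve X) (A : Set X) : Prop := γ.image ⊆ A

/-- The line integral `∫_γ ρ ds` (arclength parametrization). -/
def lineIntegral (γ : Curve X) (ρ : X → ℝ≥0∞) : ℝ≥0∞ :=
  ∫⁻ t in Set.Icc (0:ℝ) γ.len, ρ (γ.toFun t)

/-- The arclength measure of a curve, as a Borel measure on `X`. -/
def toMeasure (γ : Curve X) : Measure X :=
  Measure.map γ.toFun (volume.restrict (Set.Icc 0 γ.len))

/-- A curve joins `E` and `F` if its endpoints lie in `E` and `F` (in either order). -/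
def Joins (γ : Curve X) (E F : Set X) : Prop :=
  (γ.toFun 0 ∈ E ∧ γ.toFun γ.len ∈ F) ∨ (γ.toFun 0 ∈ F ∧ γ.toFun γ.len ∈ E)

end Curve

/-- `ρ` is admissible for a family `M` of Borel measures. -/
def Admissible (ρ : X → ℝ≥0∞) (M : Set (Measure X)) : Prop :=
  Measurable ρ ∧ ∀ lam ∈ M, 1 ≤ ∫⁻ x, ρ x ∂lam

/-- The `p`-modulus of a family of Borel measures. -/
def pMod (p : ℝ) (μ : Measure X) (M : Set (Measure X)) : ℝ≥0∞ :=
  ⨅ (ρ : X → ℝ≥0∞) (_ : Admissible ρ M), ∫⁻ x, ρ x ^ p ∂μ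

/-- `ρ` is `p`-weakly admissible for `M`: admissible outside a subfamily of `p`-modulus zero. -/
def WeaklyAdmissible (p : ℝ) (μ : Measure X) (ρ : X → ℝ≥0∞) (M : Set (Measure X)) : Prop :=
  Measurable ρ ∧ ∃ N ⊆ M, pMod p μ N = 0 ∧ ∀ lam ∈ M \ N, 1 ≤ ∫⁻ x, ρ x ∂lam

/-- The `p`-modulus of a family of (rectifiable) curves. -/
def ModCurve (p : ℝ) (μ : Measure X) (Γ : Set (Curve X)) : ℝ≥0∞ :=
  pMod p μ (Curve.toMeasure '' Γ)

/-- The family `Γ(E,F;Ω)` of curves in `Ω` joining `E ∩ Ω` and `F ∩ Ω`. -/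
def curveFamily (E F Ω : Set X) : Set (Curve X) :=
  {γ : Curve X | γ.IsIn Ω ∧ γ.Joins (E ∩ Ω) (F ∩ Ω)}

/-- `g` is an upper gradient of `u` in `Ω`. -/
def IsUpperGradientOn (u : X → ℝ) (g : X → ℝ≥0∞) (Ω : Set X) : Prop :=
  ∀ γ : Curve X, γ.IsIn Ω → γ.Nonconstant →
    ENNReal.ofReal |u (γ.toFun γ.len) - u (γ.toFun 0)| ≤ γ.lineIntegral g

/-- The Sobolev `p`-capacity `capa_p(A)`, via the Newtonian norm. -/
def sobolevCapacity (p : ℝ) (μ : Measure X) (A : Set X) : ℝ≥0∞ :=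
  ⨅ (u : X → ℝ) (_ : ∀ x ∈ A, 1 ≤ u x),
    ((∫⁻ x, ENNReal.ofReal |u x| ^ p ∂μ) ^ (1/p) +
      ⨅ (g : X → ℝ≥0∞) (_ : IsUpperGradientOn u g Set.univ), (∫⁻ x, g x ^ p ∂μ) ^ (1/p))

/-- The relative (variational) `p`-capacity `cap_p(A, Ω)`:
test functions are `≥ 1` `p`-q.e. on `A` and `≤ 0` outside `Ω`. -/
def relCapacity (p : ℝ) (μ : Measure X) (A Ω : Set X) : ℝ≥0∞ :=
  ⨅ (u : X → ℝ) (_ : sobolevCapacity p μ {x ∈ A | u x < 1} = 0)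
    (_ : ∀ x ∉ Ω, u x ≤ 0) (g : X → ℝ≥0∞) (_ : IsUpperGradientOn u g Set.univ),
    ∫⁻ x, g x ^ p ∂μ

/-- `A` is `p`-thin at `x` (Wiener-type integral converges). -/
def PThin (p : ℝ) (μ : Measure X) (A : Set X) (x : X) : Prop :=
  (∫⁻ t in Set.Ioo (0:ℝ) 1,
    (relCapacity p μ (A ∩ ball x t) (ball x (2*t)) /
      relCapacity p μ (ball x t) (ball x (2*t))) ^ (1/(p-1)) * ENNReal.ofReal t⁻¹) < ⊤

/-- The set `b_p A` of points where `A` is `p`-thick. -/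
def thickPts (p : ℝ) (μ : Measure X) (A : Set X) : Set X := {x : X | ¬ PThin p μ A x}

/-- `μ` is doubling with constant `Cd`. -/
def Doubling (μ : Measure X) (Cd : ℝ≥0∞) : Prop :=
  ∀ (x : X) (r : ℝ), 0 < r →
    0 < μ (ball x r) ∧ μ (ball x (2*r)) ≤ Cd * μ (ball x r) ∧ μ (ball x r) < ⊤

/-- `X` supports a `q`-Poincaré inequality with constants `CP`, `lam`. -/
def PoincareIneq (μ : Measure X) (q CP lam : ℝ) : Prop :=
  ∀ (u : X → ℝ) (g : X → ℝ≥0∞), IsUpperGradientOn u g Set.univ →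
    ∀ (x : X) (r : ℝ), 0 < r →
      ∫⁻ y in ball x r, ENNReal.ofReal |u y - ⨍ z in ball x r, u z ∂μ| ∂μ ≤
        ENNReal.ofReal (CP * r) * μ (ball x r) *
          ((∫⁻ y in ball x (lam * r), g y ^ q ∂μ) / μ (ball x (lam * r))) ^ (1/q)

/-- `u` is locally Lipschitz on `W`. -/
def LocLipOn (u : X → ℝ) (W : Set X) : Prop :=
  ∀ x ∈ W, ∃ r > (0:ℝ), ∃ K : ℝ≥0, LipschitzOnWith K u (ball x r ∩ W)

/-- Convergence in `L¹_loc(W)`. -/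
def L1locTendsto (μ : Measure X) (us : ℕ → X → ℝ) (u : X → ℝ) (W : Set X) : Prop :=
  ∀ K : Set X, IsCompact K → K ⊆ W →
    Tendsto (fun n => ∫⁻ x in K, ENNReal.ofReal |us n x - u x| ∂μ) atTop (𝓝 0)

/-- The total variation `‖Du‖(W)` of `u` in an open set `W`, via locally Lipschitz
approximations and their upper gradients. -/
def variation (μ : Measure X) (u : X → ℝ) (W : Set X) : ℝ≥0∞ :=
  ⨅ (us : ℕ → X → ℝ) (_ : ∀ n, LocLipOn (us n) W) (_ : L1locTendsto μ us u W),
    Filter.liminf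
      (fun n => ⨅ (g : X → ℝ≥0∞) (_ : IsUpperGradientOn (us n) g W), ∫⁻ x in W, g x ∂μ)
      atTop

/-- `P` assigns to each set `U` its perimeter measure: on open sets it is the
total variation of the characteristic function of `U`. -/
def IsPerimeter (μ : Measure X) (P : Set X → Measure X) : Prop :=
  ∀ (U W : Set X), IsOpen W → P U W = variation μ (Set.indicator U (fun _ => (1:ℝ))) W

/-- The family `𝓛(E,F;Ω)` of measures `P(U, Ω ∩ ·)` over measurable `U` with
`b_p E ∩ Ω ⊆ int U` and `b_p F ∩ Ω ⊆ ext U`. -/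
def surfaceFamily (p : ℝ) (μ : Measure X) (P : Set X → Measure X) (E F Ω : Set X) :
    Set (Measure X) :=
  {m | ∃ U : Set X, MeasurableSet U ∧ thickPts p μ E ∩ Ω ⊆ interior U ∧
        thickPts p μ F ∩ Ω ⊆ interior Uᶜ ∧ m = (P U).restrict Ω}

/-- The family `𝓛*(E,F;Ω)` of measures `P(U, Ω ∩ ·)` over measurable `U` with
`E ⊆ int U` and `F ⊆ ext U`. -/
def surfaceFamilyStar (P : Set X → Measure X) (E F Ω : Set X) : Set (Measure X) :=
  {m | ∃ U : Set X, MeasurableSet U ∧ E ⊆ interior U ∧ F ⊆ interior Uᶜ ∧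
        m = (P U).restrict Ω}

/-- The noncentered Hardy–Littlewood maximal function. -/
def maximalFn (μ : Measure X) (g : X → ℝ≥0∞) (x : X) : ℝ≥0∞ :=
  ⨆ (z : X) (r : ℝ) (_ : 0 < r) (_ : x ∈ ball z r),
    (∫⁻ y in ball z r, g y ∂μ) / μ (ball z r)

/-- The infimal `p`-energy `inf_g ∫_A g^p dμ` over upper gradients `g` of `u` in `W`. -/
def ugEnergy (p : ℝ) (μ : Measure X) (u : X → ℝ) (W A : Set X) : ℝ≥0∞ :=
  ⨅ (g : X → ℝ≥0∞) (_ : IsUpperGradientOn u g W), ∫⁻ x in A, g x ^ p ∂μ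

/-- `u` is a `p`-superminimizer in `W`. -/
def IsSuperminimizer (p : ℝ) (μ : Measure X) (u : X → ℝ) (W : Set X) : Prop :=
  ∀ φ : X → ℝ, (∃ K : ℝ≥0, LipschitzWith K φ) → HasCompactSupport φ →
    tsupport φ ⊆ W → (∀ x, 0 ≤ φ x) →
    ugEnergy p μ u W {x | φ x ≠ 0} ≤ ugEnergy p μ (fun x => u x + φ x) W {x | φ x ≠ 0}

/-- `u` is a `p`-subminimizer in `W`. -/
def IsSubminimizer (p : ℝ) (μ : Measure X) (u : X → ℝ) (W : Set X) : Prop :=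
  ∀ φ : X → ℝ, (∃ K : ℝ≥0, LipschitzWith K φ) → HasCompactSupport φ →
    tsupport φ ⊆ W → (∀ x, φ x ≤ 0) →
    ugEnergy p μ u W {x | φ x ≠ 0} ≤ ugEnergy p μ (fun x => u x + φ x) W {x | φ x ≠ 0}

/-- The lsc-regularization `u*(x) = lim_{r→0} essinf_{B(x,r)} u`. -/
def lscReg (μ : Measure X) (u : X → ℝ) (x : X) : ℝ :=
  ⨆ (r : ℝ) (_ : 0 < r), essInf u (μ.restrict (ball x r))

/-- The usc-regularization. -/
def uscReg (μ : Measure X) (u : X → ℝ) (x : X) : ℝ :=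
  ⨅ (r : ℝ) (_ : 0 < r), essSup u (μ.restrict (ball x r))

/-- The capacity of the condenser `(E,F;Ω)`. -/
def condCapacity (p : ℝ) (μ : Measure X) (E F Ω : Set X) : ℝ≥0∞ :=
  ⨅ (v : X → ℝ) (_ : ∀ x ∈ Ω, 0 ≤ v x ∧ v x ≤ 1) (_ : ∀ x ∈ E ∩ Ω, v x = 1)
    (_ : ∀ x ∈ F ∩ Ω, v x = 0), ugEnergy p μ v Ω Ω

/-- `L_f(x,r)`. -/
def eLf {Y : Type*} [MetricSpace Y] (f : X → Y) (x : X) (r : ℝ) : ℝ≥0∞ :=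
  ⨆ y ∈ closedBall x r, edist (f x) (f y)

/-- `l_f(x,r)`. -/
def elf {Y : Type*} [MetricSpace Y] (f : X → Y) (x : X) (r : ℝ) : ℝ≥0∞ :=
  ⨅ y ∈ (ball x r)ᶜ, edist (f x) (f y)

end

/-- One-dimensional compactness step behind uniform convexity. -/
lemma uc_aux (p : ℝ) (hp : 1 < p) (ε : ℝ) (hε : 0 < ε) :
    ∃ C : ℝ, 0 ≤ C ∧ ∀ t ∈ Icc (0:ℝ) 1,
      |t - (1 - t)| ^ p ≤ ε * (t ^ p + (1 - t) ^ p) +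
        C * ((t ^ p + (1 - t) ^ p) / 2 - (1 / 2 : ℝ) ^ p) := by
  have hp0 : 0 < p := by linarith
  set f : ℝ → ℝ := fun t => |t - (1 - t)| ^ p - ε * (t ^ p + (1 - t) ^ p) with hf
  set g : ℝ → ℝ := fun t => (t ^ p + (1 - t) ^ p) / 2 - (1 / 2 : ℝ) ^ p with hg
  have c1 : Continuous fun t : ℝ => t ^ p := Real.continuous_rpow_const hp0.le
  have c2 : Continuous fun t : ℝ => (1 - t) ^ p := c1.comp (continuous_const.sub continuous_id)
  have c3 : Continuous fun t : ℝ => |t - (1 - t)| ^ p :=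
    c1.comp (by fun_prop : Continuous fun t : ℝ => |t - (1 - t)|)
  have hfc : Continuous f := c3.sub (continuous_const.mul (c1.add c2))
  have hgc : Continuous g := ((c1.add c2).div_const 2).sub continuous_const
  have hgpos : ∀ t ∈ Icc (0:ℝ) 1, t ≠ 1 / 2 → 0 < g t := by
    intro t ht hne
    have := (strictConvexOn_rpow hp).2 (show t ∈ Ici (0:ℝ) from ht.1)
      (show 1 - t ∈ Ici (0:ℝ) from sub_nonneg.2 ht.2) (fun h => hne (by linarith))
      (show (0:ℝ) < 1 / 2 by norm_num) (show (0:ℝ) < 1 / 2 by norm_num) (by norm_num)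
    simp only [smul_eq_mul] at this
    rw [show 1 / 2 * t + 1 / 2 * (1 - t) = (1 / 2 : ℝ) by ring] at this
    simp only [hg]; linarith
  have hhalf : (0:ℝ) < (1 / 2 : ℝ) ^ p := by positivity
  have hghalf : g (1 / 2) = 0 := by
    simp only [hg]; rw [show (1 - 1 / 2 : ℝ) = 1 / 2 by norm_num]; ring
  have hfhalf : f (1 / 2) < 0 := by
    simp only [hf]; rw [show (1 - 1 / 2 : ℝ) = 1 / 2 by norm_num]
    rw [sub_self, abs_zero, Real.zero_rpow hp0.ne']
    have : 0 < ε * ((1 / 2 : ℝ) ^ p + (1 / 2 : ℝ) ^ p) := by positivity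
    linarith
  have hg0 : ∀ t ∈ Icc (0:ℝ) 1, 0 ≤ g t := by
    intro t ht
    by_cases h : t = 1 / 2
    · rw [h, hghalf]
    · exact (hgpos t ht h).le
  set K : Set ℝ := Icc (0:ℝ) 1 ∩ {t | 0 ≤ f t} with hK
  have hKc : IsCompact K := isCompact_Icc.inter_right (isClosed_le continuous_const hfc)
  suffices H : ∃ C : ℝ, 0 ≤ C ∧ ∀ t ∈ Icc (0:ℝ) 1, f t ≤ C * g t by
    obtain ⟨C, hC, h⟩ := H
    refine ⟨C, hC, fun t ht => ?_⟩
    have := h t ht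
    simp only [hf, hg] at this
    linarith
  have hgK : ∀ t ∈ K, 0 < g t := by
    intro t ht
    refine hgpos t ht.1 ?_
    rintro rfl
    exact absurd ht.2 (not_le.2 hfhalf)
  rcases K.eq_empty_or_nonempty with hKe | hKn
  · refine ⟨0, le_rfl, fun t ht => ?_⟩
    by_contra hc
    have : t ∈ K := ⟨ht, by show 0 ≤ f t; linarith⟩
    rw [hKe] at this; exact this
  · obtain ⟨t0, ht0, hmax⟩ := hKc.exists_isMaxOn hKn
      (hfc.continuousOn.div hgc.continuousOn (fun t ht => (hgK t ht).ne'))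
    refine ⟨f t0 / g t0, div_nonneg ht0.2 (hgK t0 ht0).le, fun t ht => ?_⟩
    by_cases htK : t ∈ K
    · have : f t / g t ≤ f t0 / g t0 := hmax htK
      rwa [div_le_iff₀ (hgK t htK)] at this
    · have hft : f t < 0 := by
        by_contra hc
        exact htK ⟨ht, not_lt.1 hc⟩
      have := mul_nonneg (div_nonneg ht0.2 (hgK t0 ht0).le) (hg0 t ht)
      linarith

lemma uc_real (p : ℝ) (hp : 1 < p) (ε : ℝ) (hε : 0 < ε) :
    ∃ C : ℝ, 0 ≤ C ∧ ∀ a b : ℝ, 0 ≤ a → 0 ≤ b →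
      |a - b| ^ p + C * ((a + b) / 2) ^ p ≤ ε * (a ^ p + b ^ p) + C * ((a ^ p + b ^ p) / 2) := by
  obtain ⟨C, hC, h⟩ := uc_aux p hp ε hε
  have hp0 : 0 < p := by linarith
  refine ⟨C, hC, fun a b ha hb => ?_⟩
  rcases (add_nonneg ha hb).eq_or_lt with hs | hs
  · have h1 : a = 0 := by linarith
    have h2 : b = 0 := by linarith
    subst h1; subst h2
    simp [Real.zero_rpow hp0.ne']
  · set s := a + b with hsdef
    have ht0 : 0 ≤ a / s := by positivity
    have ht1 : a / s ≤ 1 := by rw [div_le_one hs]; linarith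
    have hb' : 1 - a / s = b / s := by field_simp; linarith
    have key := h (a / s) ⟨ht0, ht1⟩
    rw [hb', ← _root_.sub_div, abs_div, abs_of_pos hs, Real.div_rpow (abs_nonneg _) hs.le,
      Real.div_rpow ha hs.le, Real.div_rpow hb hs.le] at key
    have hsp : 0 < s ^ p := by positivity
    have e : (s / 2) ^ p = s ^ p * (1 / 2 : ℝ) ^ p := by
      rw [← Real.mul_rpow hs.le (by norm_num)]; ring_nf
    rw [e]
    have k2 := mul_le_mul_of_nonneg_left key hsp.le
    have e1 : s ^ p * (|a - b| ^ p / s ^ p) = |a - b| ^ p := by field_simp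
    have e2 : s ^ p * (ε * (a ^ p / s ^ p + b ^ p / s ^ p) +
        C * ((a ^ p / s ^ p + b ^ p / s ^ p) / 2 - (1 / 2 : ℝ) ^ p)) =
        ε * (a ^ p + b ^ p) + C * ((a ^ p + b ^ p) / 2) - C * (s ^ p * (1 / 2 : ℝ) ^ p) := by
      field_simp
      ring
    rw [e1, e2] at k2
    linarith

/-- Pointwise uniform convexity inequality in `ℝ≥0∞`. -/
lemma uc_ennreal (p : ℝ) (hp : 1 < p) (ε : ℝ≥0) (hε : 0 < ε) :
    ∃ C : ℝ≥0, ∀ a b : ℝ≥0∞,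
      (a - b) ^ p + C * ((a + b) / 2) ^ p ≤ ε * (a ^ p + b ^ p) + C * ((a ^ p + b ^ p) / 2) := by
  obtain ⟨C, hC, h⟩ := uc_real p hp ε hε
  have hp0 : 0 < p := by linarith
  lift C to ℝ≥0 using hC
  refine ⟨C, fun a b => ?_⟩
  have hε' : (ε : ℝ≥0∞) ≠ 0 := by exact_mod_cast hε.ne'
  by_cases ha : a = ⊤
  · simp [ha, ENNReal.top_rpow_of_pos hp0, ENNReal.mul_top hε']
  by_cases hb : b = ⊤
  · simp [hb, ENNReal.top_rpow_of_pos hp0, ENNReal.mul_top hε']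
  lift a to ℝ≥0 using ha
  lift b to ℝ≥0 using hb
  have e2 : (2 : ℝ≥0∞) = ((2 : ℝ≥0) : ℝ≥0∞) := rfl
  rw [e2, ← ENNReal.coe_add, ← ENNReal.coe_sub, ← ENNReal.coe_div (by norm_num),
    ← ENNReal.coe_rpow_of_nonneg _ hp0.le, ← ENNReal.coe_rpow_of_nonneg _ hp0.le,
    ← ENNReal.coe_rpow_of_nonneg _ hp0.le, ← ENNReal.coe_rpow_of_nonneg _ hp0.le,
    ← ENNReal.coe_add, ← ENNReal.coe_div (by norm_num)]
  norm_cast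
  rw [← NNReal.coe_le_coe]
  have key := h a b a.2 b.2
  have hsub : ((a - b : ℝ≥0) : ℝ) ≤ |(a:ℝ) - b| := by
    rw [NNReal.coe_sub_def]
    exact max_le (le_abs_self _) (abs_nonneg _)
  have := Real.rpow_le_rpow (a - b).2 hsub hp0.le
  push_cast
  refine le_trans (add_le_add this le_rfl) ?_
  exact key

/-- Countable Minkowski inequality. -/
lemma mink_tsum {X : Type*} [MeasurableSpace X] (p : ℝ) (hp : 1 < p) (μ : Measure X)
    (g : ℕ → X → ℝ≥0∞) (hg : ∀ n, Measurable (g n)) :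
    (∫⁻ x, (∑' n, g n x) ^ p ∂μ) ^ (1 / p) ≤ ∑' n, (∫⁻ x, g n x ^ p ∂μ) ^ (1 / p) := by
  have hp0 : 0 < p := by linarith
  have fin : ∀ n : ℕ, (∫⁻ x, (∑ i ∈ Finset.range n, g i x) ^ p ∂μ) ^ (1 / p) ≤
      ∑ i ∈ Finset.range n, (∫⁻ x, g i x ^ p ∂μ) ^ (1 / p) := by
    intro n
    induction n with
    | zero => simp [ENNReal.zero_rpow_of_pos hp0, hp0]
    | succ n ih =>
      simp only [Finset.sum_range_succ]
      refine le_trans (ENNReal.lintegral_Lp_add_le (f := fun x => ∑ i ∈ Finset.range n, g i x)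
        (g := g n) (Finset.measurable_sum _ (fun i _ => hg i)).aemeasurable
        (hg n).aemeasurable hp.le) (add_le_add ih le_rfl)
  have lim : Tendsto (fun n : ℕ => ∫⁻ x, (∑ i ∈ Finset.range n, g i x) ^ p ∂μ) atTop
      (𝓝 (∫⁻ x, (∑' n, g n x) ^ p ∂μ)) := by
    refine lintegral_tendsto_of_tendsto_of_monotone
      (fun n => ((Finset.measurable_sum _ (fun i _ => hg i)).pow_const p).aemeasurable) ?_ ?_
    · refine Eventually.of_forall fun x m n hmn => ?_
      exact ENNReal.rpow_le_rpow
        (Finset.sum_le_sum_of_subset (Finset.range_mono hmn)) hp0.le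
    · refine Eventually.of_forall fun x => ?_
      exact ((ENNReal.continuous_rpow_const (y := p)).tendsto _).comp
        (ENNReal.tendsto_nat_tsum (fun n => g n x))
  refine le_of_tendsto (((ENNReal.continuous_rpow_const (y := 1 / p)).tendsto _).comp lim) ?_
  exact Eventually.of_forall fun n => (fin n).trans (ENNReal.sum_le_tsum _)

lemma pMod_le {X : Type*} [MetricSpace X] [MeasurableSpace X] (p : ℝ) (μ : Measure X)
    (M : Set (Measure X)) (ρ : X → ℝ≥0∞) (h : Admissible ρ M) :
    pMod p μ M ≤ ∫⁻ x, ρ x ^ p ∂μ := iInf₂_le ρ h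

/-- Almost minimizers are close to each other. -/
lemma cauchy_min {X : Type*} [MetricSpace X] [MeasurableSpace X]
    (p : ℝ) (hp : 1 < p) (μ : Measure X) (M : Set (Measure X)) (hfin : pMod p μ M ≠ ⊤)
    (η : ℝ≥0∞) (hη : 0 < η) :
    ∃ δ : ℝ≥0∞, 0 < δ ∧ ∀ a b : X → ℝ≥0∞, Admissible a M → Admissible b M →
      ∫⁻ x, a x ^ p ∂μ ≤ pMod p μ M + δ → ∫⁻ x, b x ^ p ∂μ ≤ pMod p μ M + δ →
      ∫⁻ x, (a x - b x) ^ p ∂μ ≤ η := by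
  set m := pMod p μ M with hm
  -- choose ε
  obtain ⟨ε, hε0, hε⟩ : ∃ ε : ℝ≥0, 0 < ε ∧ (ε : ℝ≥0∞) * (2 * (m + 1)) ≤ η / 2 := by
    have ht : Tendsto (fun e : ℝ≥0 => (e : ℝ≥0∞) * (2 * (m + 1))) (𝓝[>] 0) (𝓝 0) := by
      have h1 : Tendsto (fun e : ℝ≥0 => (e : ℝ≥0∞)) (𝓝[>] 0) (𝓝 ((0 : ℝ≥0) : ℝ≥0∞)) :=
        (ENNReal.continuous_coe.tendsto 0).mono_left nhdsWithin_le_nhds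
      have := ENNReal.Tendsto.mul_const (b := 2 * (m + 1)) h1
        (Or.inr (ENNReal.mul_ne_top (by simp) (by simp [hfin])))
      simpa using this
    have h2 : (0 : ℝ≥0∞) < η / 2 := ENNReal.half_pos hη.ne'
    obtain ⟨e, he1, he2⟩ := ((ht.eventually (gt_mem_nhds h2)).and self_mem_nhdsWithin).exists
    exact ⟨e, he2, he1.le⟩
  obtain ⟨C, hC⟩ := uc_ennreal p hp ε hε0
  obtain ⟨δ, hδ0, hδ1, hδ⟩ : ∃ δ : ℝ≥0∞, 0 < δ ∧ δ ≤ 1 ∧ C * δ ≤ η / 2 := by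
    refine ⟨min 1 (η / 2 / C), ?_, min_le_left _ _, ?_⟩
    · refine lt_min one_pos (ENNReal.div_pos (ENNReal.half_pos hη.ne').ne' (by simp))
    · refine le_trans (mul_le_mul_right (min_le_right _ _) _) ?_
      exact ENNReal.mul_div_le
  refine ⟨δ, hδ0, fun a b ha hb hia hib => ?_⟩
  have hmid : Admissible (fun x => (a x + b x) / 2) M := by
    refine ⟨(ha.1.add hb.1).div_const 2, fun lam hl => ?_⟩
    have mab : Measurable fun x => a x + b x := ha.1.add hb.1
    simp only [div_eq_mul_inv]
    rw [lintegral_mul_const _ mab, lintegral_add_left ha.1, ← div_eq_mul_inv]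
    rw [ENNReal.le_div_iff_mul_le (by simp) (by simp)]
    calc (1:ℝ≥0∞) * 2 = 1 + 1 := by norm_num
      _ ≤ _ := add_le_add (ha.2 lam hl) (hb.2 lam hl)
  have hmm : m ≤ ∫⁻ x, ((a x + b x) / 2) ^ p ∂μ := pMod_le p μ M _ hmid
  have map : Measurable fun x => a x ^ p := ha.1.pow_const p
  have mbp : Measurable fun x => b x ^ p := hb.1.pow_const p
  have hint : ∫⁻ x, (a x - b x) ^ p ∂μ + C * ∫⁻ x, ((a x + b x) / 2) ^ p ∂μ ≤
      ε * (∫⁻ x, a x ^ p ∂μ + ∫⁻ x, b x ^ p ∂μ) +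
        C * ((∫⁻ x, a x ^ p ∂μ + ∫⁻ x, b x ^ p ∂μ) / 2) := by
    have msub : Measurable fun x => (a x - b x) ^ p := (ha.1.sub hb.1).pow_const p
    have msum : Measurable fun x => a x ^ p + b x ^ p := map.add mbp
    have := lintegral_mono (μ := μ) (fun x => hC (a x) (b x))
    rw [lintegral_add_left msub,
      lintegral_add_left (msum.const_mul _), lintegral_const_mul _ (hmid.1.pow_const p),
      lintegral_const_mul _ msum, lintegral_const_mul _ (msum.div_const 2)] at this
    simp only [div_eq_mul_inv] at this ⊢
    rwa [lintegral_mul_const _ msum, lintegral_add_left map] at this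
  have hsum : ∫⁻ x, a x ^ p ∂μ + ∫⁻ x, b x ^ p ∂μ ≤ 2 * (m + δ) := by
    rw [two_mul]; exact add_le_add hia hib
  have hfinal : ∫⁻ x, (a x - b x) ^ p ∂μ + C * m ≤ η + C * m := by
    calc _ ≤ ∫⁻ x, (a x - b x) ^ p ∂μ + C * ∫⁻ x, ((a x + b x) / 2) ^ p ∂μ := by gcongr
      _ ≤ _ := hint
      _ ≤ ε * (2 * (m + δ)) + C * (2 * (m + δ) / 2) := by gcongr
      _ ≤ ε * (2 * (m + 1)) + C * (m + δ) := by
        gcongr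
        rw [mul_comm, ENNReal.mul_div_cancel_right (by simp) (by simp)]
      _ = ε * (2 * (m + 1)) + C * δ + C * m := by ring
      _ ≤ η / 2 + η / 2 + C * m := by gcongr
      _ = η + C * m := by rw [ENNReal.add_halves]
  exact (ENNReal.add_le_add_iff_right (ENNReal.mul_ne_top (by simp) hfin)).1 hfinal

/-- If `Mod_p(𝓛) < ∞`, then there exists a `p`-weakly admissible function attaining
the `p`-modulus of `𝓛`. -/
theorem exists_weaklyAdmissible_attaining_mod {X : Type*} [MetricSpace X] [MeasurableSpace X]
    (p : ℝ) (hp : 1 < p) (μ : Measure X) (𝓛 : Set (Measure X))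
    (hfin : pMod p μ 𝓛 < ⊤) :
    ∃ ρ : X → ℝ≥0∞, WeaklyAdmissible p μ ρ 𝓛 ∧ ∫⁻ x, ρ x ^ p ∂μ = pMod p μ 𝓛 := by
  have hp0 : 0 < p := by linarith
  have hp1 : 0 < 1 / p := by positivity
  set m := pMod p μ 𝓛 with hm
  -- minimizing sequence
  have hex : ∀ n : ℕ, ∃ r : X → ℝ≥0∞, Admissible r 𝓛 ∧ ∫⁻ x, r x ^ p ∂μ < m + ((n : ℝ≥0∞) + 1)⁻¹ := by
    intro n
    have : pMod p μ 𝓛 < m + ((n : ℝ≥0∞) + 1)⁻¹ :=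
      ENNReal.lt_add_right hfin.ne (by simp)
    rw [pMod] at this
    simp only [iInf_lt_iff] at this
    obtain ⟨r, hr, h⟩ := this
    exact ⟨r, hr, h⟩
  choose r hrA hr using hex
  have hinv : Tendsto (fun n : ℕ => ((n : ℝ≥0∞) + 1)⁻¹) atTop (𝓝 0) := by
    have := (tendsto_add_atTop_iff_nat (f := fun n : ℕ => (n : ℝ≥0∞)⁻¹) 1).2
      ENNReal.tendsto_inv_nat_nhds_zero
    simpa using this
  have hlim : Tendsto (fun n => ∫⁻ x, r n x ^ p ∂μ) atTop (𝓝 m) := by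
    have h2 : Tendsto (fun n : ℕ => m + ((n : ℝ≥0∞) + 1)⁻¹) atTop (𝓝 m) := by
      simpa using (tendsto_const_nhds (x := m)).add hinv
    exact tendsto_of_tendsto_of_tendsto_of_le_of_le tendsto_const_nhds h2
      (fun n => pMod_le p μ 𝓛 _ (hrA n)) (fun n => (hr n).le)
  obtain ⟨φ, hφ, hφP⟩ := extraction_forall_of_eventually
    (P := fun n k => ∀ i ≥ k, ∫⁻ x, (r k x - r i x) ^ p ∂μ ≤ ((2⁻¹ : ℝ≥0∞) ^ n) ^ p) (by
      intro n
      have hpos : 0 < ((2⁻¹ : ℝ≥0∞) ^ n) ^ p :=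
        ENNReal.rpow_pos (ENNReal.pow_pos (by simp) n) (ENNReal.pow_ne_top (by simp))
      obtain ⟨δ, hδ, h⟩ := cauchy_min p hp μ 𝓛 hfin.ne _ hpos
      have hev : ∀ᶠ k in atTop, ∫⁻ x, r k x ^ p ∂μ < m + δ :=
        hlim.eventually (gt_mem_nhds (ENNReal.lt_add_right hfin.ne hδ.ne'))
      obtain ⟨N, hN⟩ := eventually_atTop.1 hev
      filter_upwards [eventually_ge_atTop N] with k hk i hi
      exact h _ _ (hrA k) (hrA i) (hN k hk).le (hN i (hk.trans hi)).le)
  set f : ℕ → X → ℝ≥0∞ := fun n => r (φ n) with hf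
  have hfm : ∀ n, Measurable (f n) := fun n => (hrA (φ n)).1
  set g : ℕ → X → ℝ≥0∞ := fun n x => f n x - f (n + 1) x with hg
  have hgm : ∀ n, Measurable (g n) := fun n => (hfm n).sub (hfm (n + 1))
  have hgn : ∀ n, (∫⁻ x, g n x ^ p ∂μ) ^ (1 / p) ≤ (2⁻¹ : ℝ≥0∞) ^ n := by
    intro n
    have h1 := hφP n (φ (n + 1)) (hφ.monotone (Nat.le_succ n))
    have h2 := ENNReal.rpow_le_rpow h1 hp1.le
    rwa [← ENNReal.rpow_mul, mul_one_div_cancel hp0.ne', ENNReal.rpow_one] at h2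
  set σ : ℕ → X → ℝ≥0∞ := fun k x => ∑' j, g (j + k) x with hσ
  have hσm : ∀ k, Measurable (σ k) := fun k => Measurable.tsum fun j => hgm (j + k)
  have hgeo : ∑' n : ℕ, (2⁻¹ : ℝ≥0∞) ^ n ≠ ⊤ := by
    rw [ENNReal.tsum_geometric]; simp
  have hσn : ∀ k, (∫⁻ x, σ k x ^ p ∂μ) ^ (1 / p) ≤ ∑' j, (2⁻¹ : ℝ≥0∞) ^ (j + k) := fun k =>
    (mink_tsum p hp μ (fun j => g (j + k)) (fun j => hgm (j + k))).trans
      (ENNReal.tsum_le_tsum fun j => hgn (j + k))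
  have hσ0 : ∫⁻ x, σ 0 x ^ p ∂μ ≠ ⊤ := by
    intro h
    have := hσn 0
    rw [h, ENNReal.top_rpow_of_pos hp1] at this
    exact hgeo (by simpa using this)
  set ρ : X → ℝ≥0∞ := fun x => liminf (fun n => f n x) atTop with hρ
  have hρm : Measurable ρ := Measurable.liminf hfm
  have htel : ∀ k n x, f k x ≤ f (n + k) x + ∑ j ∈ Finset.range n, g (j + k) x := by
    intro k n x
    induction n with
    | zero => simp
    | succ n ih =>
      rw [Finset.sum_range_succ]
      have h1 : f (n + k) x ≤ f (n + 1 + k) x + g (n + k) x := by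
        rw [show n + 1 + k = n + k + 1 by ring]
        exact le_add_tsub
      calc f k x ≤ _ := ih
        _ ≤ (f (n + 1 + k) x + g (n + k) x) + ∑ j ∈ Finset.range n, g (j + k) x := by gcongr
        _ = _ := by ring
  have hle : ∀ k x, f k x ≤ ρ x + σ k x := by
    intro k x
    rw [← tsub_le_iff_right]
    refine le_liminf_of_le (by isBoundedDefault) ?_
    filter_upwards [eventually_ge_atTop k] with n hn
    obtain ⟨i, rfl⟩ := Nat.exists_eq_add_of_le' hn
    rw [tsub_le_iff_right]
    exact (htel k i x).trans (by gcongr; exact ENNReal.sum_le_tsum _)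
  refine ⟨ρ, ⟨hρm, {lam ∈ 𝓛 | ∫⁻ x, σ 0 x ∂lam = ⊤}, fun _ h => h.1, ?_, ?_⟩, ?_⟩
  · -- modulus zero
    have hb : ∀ n : ℕ, pMod p μ {lam ∈ 𝓛 | ∫⁻ x, σ 0 x ∂lam = ⊤} ≤
        (((n : ℝ≥0∞) + 1)⁻¹) ^ p * ∫⁻ x, σ 0 x ^ p ∂μ := by
      intro n
      refine (pMod_le p μ _ (fun x => ((n : ℝ≥0∞) + 1)⁻¹ * σ 0 x)
        ⟨(hσm 0).const_mul _, fun lam hl => ?_⟩).trans ?_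
      · rw [lintegral_const_mul _ (hσm 0), hl.2, ENNReal.mul_top (by simp)]
        exact le_top
      · simp only [ENNReal.mul_rpow_of_nonneg _ _ hp0.le]
        rw [lintegral_const_mul _ ((hσm 0).pow_const p)]
    have hl : Tendsto (fun n : ℕ => (((n : ℝ≥0∞) + 1)⁻¹) ^ p * ∫⁻ x, σ 0 x ^ p ∂μ) atTop (𝓝 0) := by
      have h1 := ((ENNReal.continuous_rpow_const (y := p)).tendsto 0).comp hinv
      rw [ENNReal.zero_rpow_of_pos hp0] at h1
      simpa using ENNReal.Tendsto.mul_const (b := ∫⁻ x, σ 0 x ^ p ∂μ) h1 (Or.inr hσ0)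
    exact le_antisymm (ge_of_tendsto' hl hb) (zero_le)
  · rintro lam ⟨hl, hlN⟩
    have hfinl : ∫⁻ x, σ 0 x ∂lam ≠ ⊤ := fun h => hlN ⟨hl, h⟩
    have hs : ∀ k, ∫⁻ x, σ k x ∂lam = ∑' j, ∫⁻ x, g (j + k) x ∂lam := fun k =>
      lintegral_tsum fun j => (hgm (j + k)).aemeasurable
    rw [hs 0] at hfinl
    have ht := ENNReal.tendsto_sum_nat_add (fun j => ∫⁻ x, g j x ∂lam) hfinl
    have ht2 : Tendsto (fun k => ∫⁻ x, ρ x ∂lam + ∫⁻ x, σ k x ∂lam) atTop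
        (𝓝 (∫⁻ x, ρ x ∂lam)) := by
      simp only [hs]
      simpa using tendsto_const_nhds.add ht
    refine ge_of_tendsto' ht2 fun k => ?_
    rw [← lintegral_add_left hρm]
    exact ((hrA (φ k)).2 lam hl).trans (lintegral_mono (hle k))
  · refine le_antisymm ?_ ?_
    · have hlim' : Tendsto (fun n => ∫⁻ x, f n x ^ p ∂μ) atTop (𝓝 m) :=
        hlim.comp hφ.tendsto_atTop
      rw [← hlim'.liminf_eq]
      refine le_trans (lintegral_mono fun x => ?_)
        (lintegral_liminf_le fun n => (hfm n).pow_const p)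
      have := (ENNReal.monotone_rpow_of_nonneg hp0.le).map_liminf_of_continuousAt
        (F := atTop) (fun n => f n x) (ENNReal.continuous_rpow_const.continuousAt)
      exact this.le
    · have ht := ENNReal.tendsto_sum_nat_add (fun j => (2⁻¹ : ℝ≥0∞) ^ j) hgeo
      have ht2 : Tendsto (fun k => (∫⁻ x, ρ x ^ p ∂μ) ^ (1 / p) + ∑' j, (2⁻¹ : ℝ≥0∞) ^ (j + k))
          atTop (𝓝 ((∫⁻ x, ρ x ^ p ∂μ) ^ (1 / p))) := by
        simpa using tendsto_const_nhds.add ht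
      have hroot : m ^ (1 / p) ≤ (∫⁻ x, ρ x ^ p ∂μ) ^ (1 / p) := by
        refine ge_of_tendsto' ht2 fun k => ?_
        calc m ^ (1 / p) ≤ (∫⁻ x, f k x ^ p ∂μ) ^ (1 / p) :=
              ENNReal.rpow_le_rpow (pMod_le p μ 𝓛 _ (hrA (φ k))) hp1.le
          _ ≤ (∫⁻ x, (ρ + σ k) x ^ p ∂μ) ^ (1 / p) :=
              ENNReal.rpow_le_rpow (lintegral_mono fun x =>
                ENNReal.rpow_le_rpow (hle k x) hp0.le) hp1.le
          _ ≤ _ := ENNReal.lintegral_Lp_add_le hρm.aemeasurable (hσm k).aemeasurable hp.le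
          _ ≤ _ := by gcongr; exact hσn k
      exact (ENNReal.rpow_le_rpow_iff hp1).1 hroot
end

section
/- Let \(\Omega\subset X\) be a nonempty bounded domain and let \(E,F\subset\Omega\) be disjoint nonempty compact sets. Let \(\mathcal{L}^*\) be the family of perimeter measures \(P(U,\Omega\cap\cdot)\) over measurable \(U\) with \(E\subset\mathrm{int}(U)\) and \(F\subset\mathrm{ext}(U)\). If \(\mathrm{Mod}_{p/(p-1)}(\mathcal{L}^*)<\infty\), then \(1\le\mathrm{Mod}_{p/(p-1)}(\mathcal{L}^*)^{(p-1)/p}\,\mathrm{Mod}_p(\Gamma(E,F;\Omega))^{1/p}\). -/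
open MeasureTheory Metric Set ENNReal NNReal Filter Topology

/-- Lipschitz inf-convolution of the truncation of `ρ`. -/
noncomputable def infConv {X : Type*} [MetricSpace X] (ρ : X → ℝ≥0∞) (n : ℕ) (x : X) : ℝ :=
  ⨅ y, ((min (ρ y) n).toReal + n * dist x y)

section infconv
variable {X : Type*} [MetricSpace X]

lemma infConv_bdd (ρ : X → ℝ≥0∞) (n : ℕ) (x : X) :
    BddBelow (range fun y => ((min (ρ y) n).toReal + n * dist x y)) :=
  ⟨0, by rintro _ ⟨y, rfl⟩; positivity⟩

lemma infConv_nonneg (ρ : X → ℝ≥0∞) (n : ℕ) (x : X) : 0 ≤ infConv ρ n x :=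
  Real.iInf_nonneg fun y => by positivity

lemma infConv_le_min (ρ : X → ℝ≥0∞) (n : ℕ) (x : X) :
    infConv ρ n x ≤ (min (ρ x) n).toReal := by
  have := ciInf_le (infConv_bdd ρ n x) x
  simpa [infConv] using this

lemma infConv_le_nat (ρ : X → ℝ≥0∞) (n : ℕ) (x : X) : infConv ρ n x ≤ n := by
  refine (infConv_le_min ρ n x).trans ?_
  have : (min (ρ x) n).toReal ≤ ((n : ℝ≥0∞)).toReal :=
    ENNReal.toReal_mono (by simp) (min_le_right _ _)
  simpa using this

lemma infConv_le (ρ : X → ℝ≥0∞) (n : ℕ) (x : X) : ENNReal.ofReal (infConv ρ n x) ≤ ρ x := by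
  refine (ENNReal.ofReal_le_ofReal (infConv_le_min ρ n x)).trans ?_
  rw [ENNReal.ofReal_toReal (ne_top_of_le_ne_top (by simp) (min_le_right _ _))]
  exact min_le_left _ _

lemma infConv_lip (ρ : X → ℝ≥0∞) (n : ℕ) (x y : X) :
    infConv ρ n x ≤ infConv ρ n y + n * dist x y := by
  have : Nonempty X := ⟨x⟩
  rw [← sub_le_iff_le_add]
  refine le_ciInf fun z => ?_
  rw [sub_le_iff_le_add]
  refine (ciInf_le (infConv_bdd ρ n x) z).trans ?_
  have : (n : ℝ) * dist x z ≤ n * (dist x y + dist y z) :=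
    mul_le_mul_of_nonneg_left (dist_triangle _ _ _) (by positivity)
  linarith

lemma infConv_continuous (ρ : X → ℝ≥0∞) (n : ℕ) : Continuous (infConv ρ n) := by
  refine (LipschitzWith.of_le_add_mul (n : ℝ≥0) fun x y => ?_).continuous
  simpa using infConv_lip ρ n x y

lemma infConv_mono (ρ : X → ℝ≥0∞) {n m : ℕ} (h : n ≤ m) (x : X) :
    infConv ρ n x ≤ infConv ρ m x := by
  have : Nonempty X := ⟨x⟩
  refine le_ciInf fun z => (ciInf_le (infConv_bdd ρ n x) z).trans ?_
  have h' : (n : ℝ) ≤ m := by exact_mod_cast h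
  have h1 : (min (ρ z) n).toReal ≤ (min (ρ z) m).toReal :=
    ENNReal.toReal_mono (ne_top_of_le_ne_top (by simp) (min_le_right _ _))
      (min_le_min le_rfl (by exact_mod_cast h))
  have h2 : (n : ℝ) * dist x z ≤ m * dist x z := mul_le_mul_of_nonneg_right h' dist_nonneg
  linarith

/-- Lower bound: if `ρ ≥ a` on the ball of radius `r`, with `a ≤ n` and `a ≤ n r`. -/
lemma le_infConv (ρ : X → ℝ≥0∞) (n : ℕ) (x : X) (a r : ℝ)
    (h : ∀ y, dist x y < r → ENNReal.ofReal a ≤ ρ y) (han : a ≤ n) (har : a ≤ n * r) :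
    a ≤ infConv ρ n x := by
  have : Nonempty X := ⟨x⟩
  refine le_ciInf fun z => ?_
  rcases lt_or_ge (dist x z) r with hz | hz
  · have h1 : ENNReal.ofReal a ≤ min (ρ z) n := by
      refine le_min (h z hz) ?_
      rw [← ENNReal.ofReal_natCast]
      exact ENNReal.ofReal_le_ofReal han
    have h2 : a ≤ (min (ρ z) n).toReal :=
      (ENNReal.ofReal_le_iff_le_toReal (ne_top_of_le_ne_top (by simp) (min_le_right _ _))).1 h1
    have : 0 ≤ (n : ℝ) * dist x z := by positivity
    linarith
  · have h1 : (n : ℝ) * r ≤ n * dist x z := mul_le_mul_of_nonneg_left hz (by positivity)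
    have : 0 ≤ (min (ρ z) n).toReal := ENNReal.toReal_nonneg
    linarith

lemma infConv_liminf {ρ : X → ℝ≥0∞} (hρ : LowerSemicontinuous ρ) {N : ℕ → ℕ}
    (hN : Tendsto N atTop atTop) {y : ℕ → X} {x : X} (hy : Tendsto y atTop (𝓝 x)) :
    ρ x ≤ liminf (fun k => ENNReal.ofReal (infConv ρ (N k) (y k))) atTop := by
  refine le_of_forall_lt fun a ha => ?_
  obtain ⟨b, hab, hb⟩ := exists_between ha
  refine hab.trans_le ?_
  refine le_liminf_of_le (by isBoundedDefault) ?_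
  have hbt : b ≠ ⊤ := (hb.trans_le le_top).ne
  obtain ⟨r, hr, hball⟩ := Metric.eventually_nhds_iff.1 (hρ x b hb)
  have e1 : ∀ᶠ k in atTop, dist (y k) x < r / 2 := (Metric.tendsto_nhds.1 hy) _ (by linarith)
  have e2 : ∀ᶠ k in atTop, b.toReal ≤ N k :=
    (tendsto_natCast_atTop_atTop.comp hN).eventually_ge_atTop _
  have e3 : ∀ᶠ k in atTop, b.toReal / (r / 2) ≤ N k :=
    (tendsto_natCast_atTop_atTop.comp hN).eventually_ge_atTop _
  filter_upwards [e1, e2, e3] with k h1 h2 h3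
  rw [← ENNReal.ofReal_toReal hbt]
  refine ENNReal.ofReal_le_ofReal (le_infConv ρ _ _ _ (r / 2) (fun z hz => ?_) h2 ?_)
  · rw [ENNReal.ofReal_toReal hbt]
    refine (hball ?_).le
    calc dist z x ≤ dist z (y k) + dist (y k) x := dist_triangle _ _ _
      _ < r := by rw [dist_comm z]; linarith
  · rwa [div_le_iff₀ (by linarith)] at h3
end infconv

/-- Existence of a coarse path of cost at most `c`. -/
def HasPath {X : Type*} [MetricSpace X] [MeasurableSpace X] (E A : Set X) (δ : ℝ) (φ : X → ℝ)
    (x : X) (c : ℝ) : Prop :=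
  ∃ T : ℝ, ∃ f : ℝ → X, 0 ≤ T ∧ Measurable f ∧ (∀ s t, dist (f s) (f t) ≤ |s - t| + δ) ∧
    f 0 ∈ E ∧ f T = x ∧ (∀ t, f t ∈ A) ∧
    ∫⁻ t in Ico 0 T, ENNReal.ofReal (φ (f t)) ≤ ENNReal.ofReal c

/-- The coarse distance to `E` (truncated at `1`). -/
noncomputable def cdist {X : Type*} [MetricSpace X] [MeasurableSpace X] (E A : Set X) (δ : ℝ)
    (φ : X → ℝ) (x : X) : ℝ :=
  sInf {c | 0 ≤ c ∧ (c = 1 ∨ HasPath E A δ φ x c)}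

section cdist
variable {X : Type*} [MetricSpace X] [MeasurableSpace X]

lemma cdist_bdd (E A : Set X) (δ : ℝ) (φ : X → ℝ) (x : X) :
    BddBelow {c | 0 ≤ c ∧ (c = 1 ∨ HasPath E A δ φ x c)} := ⟨0, fun _ h => h.1⟩

lemma cdist_ne (E A : Set X) (δ : ℝ) (φ : X → ℝ) (x : X) :
    {c | 0 ≤ c ∧ (c = 1 ∨ HasPath E A δ φ x c)}.Nonempty := ⟨1, by simp⟩

lemma cdist_nonneg (E A : Set X) (δ : ℝ) (φ : X → ℝ) (x : X) : 0 ≤ cdist E A δ φ x :=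
  le_csInf (cdist_ne E A δ φ x) fun _ h => h.1

lemma cdist_le_one (E A : Set X) (δ : ℝ) (φ : X → ℝ) (x : X) : cdist E A δ φ x ≤ 1 :=
  csInf_le (cdist_bdd E A δ φ x) (by simp)

lemma cdist_eq_zero {E A : Set X} (hEA : E ⊆ A) {δ : ℝ} (hδ : 0 ≤ δ) (φ : X → ℝ) {x : X}
    (hx : x ∈ E) : cdist E A δ φ x = 0 := by
  refine le_antisymm (csInf_le (cdist_bdd E A δ φ x) ⟨le_rfl, Or.inr ?_⟩) (cdist_nonneg _ _ _ _ _)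
  refine ⟨0, fun _ => x, le_rfl, measurable_const, fun s t => ?_, hx, rfl, fun _ => hEA hx, ?_⟩
  · rw [dist_self]; positivity
  · simp

lemma cdist_mono {E A A' : Set X} {δ δ' : ℝ} {φ φ' : X → ℝ} (hA : A ⊆ A') (hδ : δ ≤ δ')
    (hφ : ∀ x, φ' x ≤ φ x) (x : X) : cdist E A' δ' φ' x ≤ cdist E A δ φ x := by
  refine csInf_le_csInf (cdist_bdd _ _ _ _ _) (cdist_ne _ _ _ _ _) ?_
  rintro c ⟨h0, h1 | ⟨T, f, hT, hm, hl, h3, h4, h5, h6⟩⟩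
  · exact ⟨h0, Or.inl h1⟩
  · refine ⟨h0, Or.inr ⟨T, f, hT, hm, fun s t => (hl s t).trans (by linarith), h3, h4,
      fun t => hA (h5 t), le_trans (lintegral_mono fun t => ?_) h6⟩⟩
    exact ENNReal.ofReal_le_ofReal (hφ _)

lemma exists_path_of_cdist_lt {E A : Set X} {δ : ℝ} {φ : X → ℝ} {x : X} {c : ℝ}
    (h : cdist E A δ φ x < c) (hc : c < 1) : HasPath E A δ φ x c := by
  obtain ⟨b, ⟨hb0, hb⟩, hbc⟩ := exists_lt_of_csInf_lt (cdist_ne E A δ φ x) h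
  rcases hb with rfl | ⟨T, f, hT, hm, hl, h3, h4, h5, h6⟩
  · linarith
  · exact ⟨T, f, hT, hm, hl, h3, h4, h5, h6.trans (ENNReal.ofReal_le_ofReal hbc.le)⟩

lemma cdist_notMem {E A : Set X} {δ : ℝ} {φ : X → ℝ} {x : X} (hx : x ∉ A) :
    cdist E A δ φ x = 1 := by
  refine le_antisymm (cdist_le_one _ _ _ _ _) (le_csInf (cdist_ne _ _ _ _ _) ?_)
  rintro c ⟨h0, h1 | ⟨T, f, hT, hm, hl, h3, h4, h5, h6⟩⟩
  · exact h1.ge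
  · exact absurd (h4 ▸ h5 T) hx

lemma HasPath.extend {E A : Set X} {δ : ℝ} {φ : X → ℝ} (hφ : ∀ x, 0 ≤ φ x)
    {x y : X} {c : ℝ} (hc : 0 ≤ c) (h : HasPath E A δ φ x c) (hy : y ∈ A) (hxy : dist x y ≤ δ) :
    HasPath E A δ φ y (c + φ x * dist x y) := by
  by_cases hne : x = y
  · subst hne; simpa using h
  obtain ⟨T, f, hT, hm, hl, h3, h4, h5, h6⟩ := h
  have hd : 0 < dist x y := dist_pos.2 hne
  set d := dist x y with hdd
  refine ⟨T + d, fun t => if t < T then f t else if t < T + d then x else y, by linarith,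
    ?_, ?_, ?_, ?_, ?_, ?_⟩
  · exact Measurable.ite measurableSet_Iio hm
      (Measurable.ite measurableSet_Iio measurable_const measurable_const)
  · have key : ∀ s t, s ≤ t → dist (if s < T then f s else if s < T + d then x else y)
        (if t < T then f t else if t < T + d then x else y) ≤ t - s + δ := by
      intro s t hst
      have h7 : ∀ s, s < T → dist (f s) x ≤ T - s + δ := by
        intro s hs
        have := hl s T
        rw [h4, abs_of_nonpos (by linarith)] at this
        linarith
      split_ifs with a b e a b e
      · have := hl s t
        rw [abs_of_nonpos (by linarith)] at this
        linarith
      · have := h7 s a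
        linarith
      · have := h7 s a
        have h8 := dist_triangle (f s) x y
        rw [← hdd] at h8
        linarith
      all_goals first
        | (exfalso; linarith)
        | (rw [dist_self]; linarith)
        | (rw [← hdd]; linarith)
    intro s t
    rcases le_total s t with hst | hst
    · rw [abs_of_nonpos (by linarith)]
      have := key s t hst
      linarith
    · rw [abs_of_nonneg (by linarith), dist_comm]
      exact key t s hst
  · rcases hT.eq_or_lt with h0 | h0
    · subst h0
      simp only [lt_irrefl, if_false, zero_add, hd, if_true]
      rwa [← h4]
    · simpa [h0] using h3
  · simp [hd.le]
  · intro t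
    dsimp only
    split_ifs
    · exact h5 t
    · exact h4 ▸ h5 T
    · exact hy
  · rw [← Ico_union_Ico_eq_Ico hT (by linarith : T ≤ T + d),
      lintegral_union measurableSet_Ico Ico_disjoint_Ico_same,
      ENNReal.ofReal_add hc (mul_nonneg (hφ x) hd.le)]
    refine add_le_add ?_ ?_
    · refine le_trans (le_of_eq ?_) h6
      refine setLIntegral_congr_fun measurableSet_Ico fun t ht => ?_
      simp [ht.2]
    · rw [setLIntegral_congr_fun (g := fun _ => ENNReal.ofReal (φ x)) measurableSet_Ico]
      · simp [ENNReal.ofReal_mul (hφ x)]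
      · intro t ht
        simp [ht.2, not_lt.2 ht.1]

lemma cdist_le_add {E A : Set X} {δ : ℝ} {φ : X → ℝ} (hφ : ∀ x, 0 ≤ φ x)
    {x y : X} (hy : y ∈ A) (hxy : dist x y ≤ δ) :
    cdist E A δ φ y ≤ cdist E A δ φ x + φ x * dist x y := by
  have h0 : 0 ≤ φ x * dist x y := mul_nonneg (hφ x) dist_nonneg
  rw [← sub_le_iff_le_add]
  refine le_csInf (cdist_ne _ _ _ _ _) ?_
  rintro c ⟨hc, h1 | h1⟩
  · have := cdist_le_one E A δ φ y
    linarith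
  · rw [sub_le_iff_le_add]
    exact csInf_le (cdist_bdd _ _ _ _ _) ⟨by linarith, Or.inr (h1.extend hφ hc hy hxy)⟩

lemma cdist_abs_le {E A : Set X} {δ : ℝ} {φ : X → ℝ} (hφ : ∀ x, 0 ≤ φ x)
    {x y : X} (hx : x ∈ A) (hy : y ∈ A) (hxy : dist x y ≤ δ) :
    |cdist E A δ φ x - cdist E A δ φ y| ≤ max (φ x) (φ y) * dist x y := by
  have h1 := cdist_le_add (E := E) hφ hy hxy
  have h2 := cdist_le_add (E := E) (δ := δ) (A := A) hφ hx (by rwa [dist_comm])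
  rw [dist_comm y x] at h2
  have h3 := mul_le_mul_of_nonneg_right (le_max_left (φ x) (φ y)) (dist_nonneg (x := x) (y := y))
  have h4 := mul_le_mul_of_nonneg_right (le_max_right (φ x) (φ y)) (dist_nonneg (x := x) (y := y))
  rw [abs_le]
  constructor <;> linarith

lemma cdist_measurable [BorelSpace X] {E A : Set X} (hA : IsClosed A) {δ : ℝ} (hδ : 0 < δ)
    {φ : X → ℝ} (hφ : ∀ x, 0 ≤ φ x) {M : ℝ} (hM : ∀ x, φ x ≤ M) :
    Measurable (cdist E A δ φ) := by
  have hcont : ContinuousOn (cdist E A δ φ) A := by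
    intro x hx
    rw [Metric.continuousWithinAt_iff]
    intro ε hε
    refine ⟨min δ (ε / (|M| + 1)), lt_min hδ (by positivity), fun y hy hyx => ?_⟩
    have h1 := cdist_abs_le (E := E) hφ hy hx (hyx.le.trans (min_le_left _ _))
    rw [Real.dist_eq]
    have h2 : max (φ y) (φ x) * dist y x ≤ (|M| + 1) * dist y x := by
      refine mul_le_mul_of_nonneg_right ?_ dist_nonneg
      have := le_abs_self M
      exact max_le ((hM y).trans (by linarith)) ((hM x).trans (by linarith))
    have h3 : dist y x < ε / (|M| + 1) := hyx.trans_le (min_le_right _ _)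
    rw [lt_div_iff₀ (by positivity)] at h3
    linarith [mul_comm (|M| + 1) (dist y x)]
  classical
  have heq : cdist E A δ φ = A.piecewise (cdist E A δ φ) (fun _ => 1) := by
    funext x
    by_cases hx : x ∈ A
    · simp [hx]
    · simp [hx, cdist_notMem hx]
  rw [heq]
  exact hcont.measurable_piecewise continuousOn_const hA.measurableSet
end cdist

lemma clamp_lip (T s t : ℝ) : |max 0 (min s T) - max 0 (min t T)| ≤ |s - t| := by
  have h1 : |max 0 (min s T) - max 0 (min t T)| ≤ |min s T - min t T| := by
    have := abs_max_sub_max_le_max 0 (min s T) 0 (min t T)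
    simpa using this
  refine h1.trans ?_
  have := abs_min_sub_min_le_max s T t T
  simpa using this

lemma limit_curve {X : Type*} [MetricSpace X] [MeasurableSpace X] [BorelSpace X] [CompleteSpace X]
    {ρ : X → ℝ≥0∞} (hρ : LowerSemicontinuous ρ) {ε0 : ℝ} (hε0 : 0 < ε0) (hε1 : ε0 ≤ 1)
    (hρε : ∀ x, ENNReal.ofReal ε0 ≤ ρ x) {E A : Set X} (hE : IsClosed E) (hA : IsClosed A)
    {K : ℕ → Set X} (hK : ∀ k, IsCompact (K k)) (hEK : ∀ k, E ⊆ K k)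
    (hρK : ∀ k, ∀ x ∉ K k, ENNReal.ofReal (2 ^ k) ≤ ρ x) {c : ℝ} (hc : c < 1) {x : X}
    (h : ∀ n : ℕ, HasPath E A (1 / ((n : ℝ) + 1)) (infConv ρ (n + 1)) x c) :
    ∃ γ : Curve X, γ.toFun 0 ∈ E ∧ γ.toFun γ.len = x ∧ γ.IsIn A ∧
      γ.lineIntegral ρ ≤ ENNReal.ofReal c := by
  choose T f hT hm hl h0 hx hfA hcost using h
  have hc1 : ENNReal.ofReal c < 1 := by
    rw [← ENNReal.ofReal_one]; exact (ENNReal.ofReal_lt_ofReal_iff one_pos).2 hc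
  have hlow : ∀ n y, ε0 ≤ infConv ρ (n + 1) y := by
    intro n y
    have : (0 : ℝ) ≤ n := by positivity
    refine le_infConv ρ _ _ ε0 1 (fun z _ => hρε z) ?_ ?_ <;> push_cast <;> linarith
  have hTle : ∀ n, T n ≤ 1 / ε0 := by
    intro n
    have h1 : ENNReal.ofReal (ε0 * T n) ≤ ENNReal.ofReal 1 := by
      rw [ENNReal.ofReal_one]
      refine le_trans ?_ ((hcost n).trans hc1.le)
      calc ENNReal.ofReal (ε0 * T n) = ∫⁻ t in Ico 0 (T n), ENNReal.ofReal ε0 := by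
            simp [ENNReal.ofReal_mul hε0.le]
        _ ≤ _ := lintegral_mono fun t => ENNReal.ofReal_le_ofReal (hlow n _)
    rw [ENNReal.ofReal_le_ofReal_iff (by norm_num)] at h1
    rw [le_div_iff₀ hε0]; linarith
  set F : ℕ → ℝ → X := fun n t => f n (max 0 (min t (T n))) with hF
  have hFl : ∀ n s t, dist (F n s) (F n t) ≤ |s - t| + 1 / ((n : ℝ) + 1) := fun n s t =>
    (hl n _ _).trans (by have := clamp_lip (T n) s t; linarith)
  -- tightness
  have htight : ∀ (k n : ℕ) (t : ℝ), (2 : ℝ) ^ k ≤ n + 1 → ∃ z ∈ K k,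
      dist (F n t) z ≤ (2 ^ k)⁻¹ + 1 / ((n : ℝ) + 1) + 2 ^ k / ((n : ℝ) + 1) := by
    intro k n t hkn
    have hn : (0 : ℝ) < n + 1 := by positivity
    have h2k : (0 : ℝ) < 2 ^ k := by positivity
    set t' := max 0 (min t (T n)) with ht'
    have ht0 : 0 ≤ t' := le_max_left _ _
    have htT : t' ≤ T n := max_le (hT n) (min_le_right _ _)
    have hp : 0 < (2 : ℝ) ^ k / ((n : ℝ) + 1) := by positivity
    rcases le_or_gt t' (2 ^ k)⁻¹ with hle | hgt
    · refine ⟨f n 0, hEK k (h0 n), ?_⟩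
      have := hl n t' 0
      rw [sub_zero, abs_of_nonneg ht0] at this
      change dist (f n t') (f n 0) ≤ _
      linarith
    · by_contra hcon
      push Not at hcon
      have hall : ∀ s ∈ Ico (t' - (2 ^ k)⁻¹) t', (2 : ℝ) ^ k ≤ infConv ρ (n + 1) (f n s) := by
        intro s hs
        refine le_infConv ρ _ _ _ (2 ^ k / ((n : ℝ) + 1)) (fun y hy => hρK k y fun hyK => ?_) ?_ ?_
        · have h1 := hcon y hyK
          have h2 := hl n t' s
          rw [abs_of_nonneg (by linarith [hs.2])] at h2
          have h3 := dist_triangle (f n t') (f n s) y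
          change _ < dist (f n t') y at h1
          linarith [hs.1]
        · push_cast; exact hkn
        · push_cast; rw [mul_div_cancel₀ _ hn.ne']
      have h4 : (1 : ℝ≥0∞) ≤ ENNReal.ofReal c := by
        refine le_trans ?_ (hcost n)
        calc (1 : ℝ≥0∞) = ∫⁻ s in Ico (t' - (2 ^ k)⁻¹) t', ENNReal.ofReal (2 ^ k) := by
              rw [lintegral_const, Measure.restrict_apply MeasurableSet.univ, univ_inter,
                Real.volume_Ico, ← ENNReal.ofReal_mul h2k.le]
              rw [show (2 : ℝ) ^ k * (t' - (t' - (2 ^ k)⁻¹)) = 1 by field_simp; ring, ENNReal.ofReal_one]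
          _ ≤ ∫⁻ s in Ico (t' - (2 ^ k)⁻¹) t', ENNReal.ofReal (infConv ρ (n + 1) (f n s)) :=
              setLIntegral_mono' measurableSet_Ico fun s hs =>
                ENNReal.ofReal_le_ofReal (hall s hs)
          _ ≤ _ := lintegral_mono_set (Ico_subset_Ico (by linarith) htT)
      exact absurd h4 (not_le.2 hc1)
  have htb : ∀ t, TotallyBounded (range fun n => F n t) := by
    intro t
    rw [Metric.totallyBounded_iff]
    intro ε hε
    obtain ⟨k, hk⟩ := exists_pow_lt_of_lt_one (show 0 < ε / 8 by linarith)
      (show (2⁻¹ : ℝ) < 1 by norm_num)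
    rw [inv_pow] at hk
    have h2k : (1 : ℝ) ≤ 2 ^ k := one_le_pow₀ (by norm_num)
    obtain ⟨N, hN⟩ := exists_nat_gt ((2 : ℝ) ^ k / (ε / 8) + 2 ^ k)
    obtain ⟨S, hSK, hSf, hS⟩ := (hK k).finite_cover_balls (show 0 < ε / 2 by linarith)
    refine ⟨S ∪ (fun n => F n t) '' Iio N, hSf.union ((finite_Iio N).image _), ?_⟩
    rintro _ ⟨n, rfl⟩
    rcases lt_or_ge n N with hn | hn
    · exact mem_biUnion (Or.inr ⟨n, hn, rfl⟩) (mem_ball_self hε)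
    · have hnN : (N : ℝ) ≤ n := by exact_mod_cast hn
      have h5 : 0 < (2 : ℝ) ^ k / (ε / 8) := by positivity
      obtain ⟨z, hz, hzd⟩ := htight k n t (by linarith)
      obtain ⟨y, hy, hyz⟩ := mem_iUnion₂.1 (hS hz)
      refine mem_biUnion (Or.inl hy) ?_
      have hn1 : (0 : ℝ) < n + 1 := by positivity
      have h6 : (2 : ℝ) ^ k / ((n : ℝ) + 1) < ε / 8 := by
        rw [div_lt_iff₀ hn1]
        have : (2 : ℝ) ^ k / (ε / 8) < n + 1 := by linarith
        rw [div_lt_iff₀ (by linarith)] at this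
        linarith
      have h7 : 1 / ((n : ℝ) + 1) ≤ 2 ^ k / ((n : ℝ) + 1) := by gcongr
      rw [mem_ball] at hyz ⊢
      have h8 := dist_triangle (F n t) z y
      linarith
  have hcomp : ∀ t, IsCompact (closure (range fun n => F n t)) := fun t =>
    isCompact_iff_totallyBounded_isComplete.2 ⟨(htb t).closure, isClosed_closure.isComplete⟩
  -- extraction
  have hprod : IsCompact ((Icc (0 : ℝ) (1 / ε0)) ×ˢ
      (univ.pi fun q : ℚ => closure (range fun n => F n (q : ℝ)))) :=
    isCompact_Icc.prod (isCompact_univ_pi fun q => hcomp q)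
  obtain ⟨⟨T', g⟩, hmem, θ, hθ, hlim⟩ := hprod.tendsto_subseq
    (x := fun n => (T n, fun q : ℚ => F n (q : ℝ)))
    (fun n => ⟨⟨hT n, hTle n⟩, fun q _ => subset_closure ⟨n, rfl⟩⟩)
  rw [nhds_prod_eq] at hlim
  have hTlim : Tendsto (fun k => T (θ k)) atTop (𝓝 T') := hlim.fst
  have hglim : ∀ q : ℚ, Tendsto (fun k => F (θ k) (q : ℝ)) atTop (𝓝 (g q)) :=
    tendsto_pi_nhds.1 hlim.snd
  have hT'0 : 0 ≤ T' := hmem.1.1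
  have hδlim : Tendsto (fun k => 1 / (((θ k : ℕ) : ℝ) + 1)) atTop (𝓝 0) :=
    (tendsto_one_div_add_atTop_nhds_zero_nat (𝕜 := ℝ)).comp hθ.tendsto_atTop
  have hcau : ∀ t, CauchySeq fun k => F (θ k) t := by
    intro t
    rw [Metric.cauchySeq_iff]
    intro ε hε
    obtain ⟨q, hq1, hq2⟩ := exists_rat_btwn (show t < t + ε / 8 by linarith)
    have e1 := (Metric.tendsto_nhds.1 (hglim q)) (ε / 8) (by linarith)
    have e2 := hδlim.eventually_lt_const (show (0 : ℝ) < ε / 8 by linarith)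
    obtain ⟨N, hN⟩ := eventually_atTop.1 (e1.and e2)
    have key : ∀ k ≥ N, dist (F (θ k) t) (g q) < 3 * (ε / 8) := by
      intro k hk
      obtain ⟨a1, a2⟩ := hN k hk
      have a3 := hFl (θ k) t q
      rw [abs_of_nonpos (by linarith)] at a3
      have := dist_triangle (F (θ k) t) (F (θ k) q) (g q)
      linarith
    refine ⟨N, fun m hm n hn => ?_⟩
    have b1 := key m hm
    have b2 := key n hn
    have := dist_triangle_right (F (θ m) t) (F (θ n) t) (g q)
    linarith
  choose γ hγ using fun t => cauchySeq_tendsto_of_complete (hcau t)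
  have hlip : ∀ s t, dist (γ s) (γ t) ≤ |s - t| := by
    intro s t
    have := le_of_tendsto_of_tendsto' ((hγ s).dist (hγ t))
      (tendsto_const_nhds.add hδlim) (fun k => hFl (θ k) s t)
    simpa using this
  refine ⟨⟨T', hT'0, γ, ?_⟩, ?_, ?_, ?_, ?_⟩
  · refine LipschitzOnWith.of_dist_le_mul fun s _ t _ => ?_
    simpa [Real.dist_eq] using hlip s t
  · refine hE.mem_of_tendsto (hγ 0) (Eventually.of_forall fun k => ?_)
    have : F (θ k) 0 = f (θ k) 0 := by simp [hF, hT]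
    rw [this]; exact h0 _
  · change γ T' = x
    have h1 : ∀ k, F (θ k) (T (θ k)) = x := by
      intro k; simp [hF, hT, hx]
    have h2 : Tendsto (fun k => dist (F (θ k) T') x) atTop (𝓝 0) := by
      refine squeeze_zero (fun _ => dist_nonneg) (g := fun k => |T' - T (θ k)| +
        1 / (((θ k : ℕ) : ℝ) + 1)) (fun k => ?_) ?_
      · have := hFl (θ k) T' (T (θ k))
        rwa [h1] at this
      · have : Tendsto (fun k => |T' - T (θ k)|) atTop (𝓝 |T' - T'|) :=
          (tendsto_const_nhds.sub hTlim).abs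
        simpa using this.add hδlim
    exact tendsto_nhds_unique (hγ T') (tendsto_iff_dist_tendsto_zero.2 h2)
  · rintro _ ⟨t, _, rfl⟩
    exact hA.mem_of_tendsto (hγ t) (Eventually.of_forall fun k => hfA _ _)
  · change ∫⁻ t in Icc 0 T', ρ (γ t) ≤ _
    rw [← setLIntegral_congr (Ioo_ae_eq_Icc (μ := volume) (a := (0 : ℝ)) (b := T'))]
    set G : ℕ → ℝ → ℝ≥0∞ := fun k => (Ico 0 (T (θ k))).indicator
      fun t => ENNReal.ofReal (infConv ρ (θ k + 1) (f (θ k) t)) with hG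
    have hGm : ∀ k, Measurable (G k) := fun k =>
      Measurable.indicator (ENNReal.measurable_ofReal.comp
        ((infConv_continuous ρ _).measurable.comp (hm _))) measurableSet_Ico
    calc ∫⁻ t in Ioo 0 T', ρ (γ t) ≤ ∫⁻ t in Ioo 0 T', liminf (fun k => G k t) atTop := by
          refine setLIntegral_mono' measurableSet_Ioo fun t ht => ?_
          refine (infConv_liminf hρ (N := fun k => θ k + 1)
            (tendsto_atTop_mono (fun k => Nat.le_succ _) hθ.tendsto_atTop) (hγ t)).trans ?_
          refine le_of_eq (liminf_congr ?_)
          filter_upwards [hTlim.eventually_const_lt ht.2] with k hk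
          have : F (θ k) t = f (θ k) t := by simp [hF, hk.le, ht.1.le]
          simp only [hG]
          rw [this, indicator_of_mem (show t ∈ Ico 0 (T (θ k)) from ⟨ht.1.le, hk⟩)]
      _ ≤ ∫⁻ t, liminf (fun k => G k t) atTop := setLIntegral_le_lintegral _ _
      _ ≤ liminf (fun k => ∫⁻ t, G k t) atTop := lintegral_liminf_le hGm
      _ ≤ liminf (fun _ : ℕ => ENNReal.ofReal c) atTop := by
          refine liminf_le_liminf (Eventually.of_forall fun k => ?_)
          change ∫⁻ t, G k t ≤ _
          rw [hG, lintegral_indicator measurableSet_Ico]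
          exact hcost _
      _ = _ := by simp

/-- Pointwise Lipschitz constant of `F` at `x` is at most `c`. -/
def LipAt {X : Type*} [MetricSpace X] (F : X → ℝ) (x : X) (c : ℝ) : Prop :=
  ∀ ε > 0, ∀ᶠ y in 𝓝 x, |F y - F x| ≤ (c + ε) * dist y x

lemma upperGradient_of_lipAt {X : Type*} [MetricSpace X] [MeasurableSpace X]
    {F : X → ℝ} {g : X → ℝ≥0∞} {W : Set X} (hF : LocLipOn F W)
    (h : ∀ x ∈ W, ∃ c, 0 ≤ c ∧ ENNReal.ofReal c ≤ g x ∧ LipAt F x c) :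
    IsUpperGradientOn F g W := by
  intro γ hγ _
  have hin : ∀ t ∈ Icc 0 γ.len, γ.toFun t ∈ W := fun t ht => hγ ⟨t, ht, rfl⟩
  have hcont := γ.lip.continuousOn
  have hll : LocallyLipschitzOn (Icc 0 γ.len) (fun t => F (γ.toFun t)) := by
    intro t ht
    obtain ⟨r, hr, K, hK⟩ := hF _ (hin t ht)
    refine ⟨K * 1, Icc 0 γ.len ∩ γ.toFun ⁻¹' (ball (γ.toFun t) r), ?_, ?_⟩
    · exact inter_mem self_mem_nhdsWithin ((hcont t ht) (ball_mem_nhds _ hr))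
    · refine hK.comp (γ.lip.mono inter_subset_left) ?_
      rintro s ⟨hs1, hs2⟩
      exact ⟨hs2, hin s hs1⟩
  obtain ⟨K, hK⟩ := hll.exists_lipschitzOnWith_of_compact isCompact_Icc
  have hac : AbsolutelyContinuousOnInterval (fun t => F (γ.toFun t)) 0 γ.len := by
    refine LipschitzOnWith.absolutelyContinuousOnInterval (K := K) ?_
    rwa [uIcc_of_le γ.len_nonneg]
  have hftc := hac.integral_deriv_eq_sub
  rw [intervalIntegral.integral_of_le γ.len_nonneg] at hftc
  rw [← hftc]
  have h1 := enorm_integral_le_lintegral_enorm (μ := volume.restrict (Ioc 0 γ.len))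
    (fun t => deriv (fun t => F (γ.toFun t)) t)
  rw [← Real.enorm_eq_ofReal_abs]
  refine h1.trans ?_
  unfold Curve.lineIntegral
  rw [setLIntegral_congr (Ioc_ae_eq_Icc (μ := volume) (a := (0 : ℝ)) (b := γ.len)),
    ← setLIntegral_congr (Ioo_ae_eq_Icc (μ := volume) (a := (0 : ℝ)) (b := γ.len)),
    ← setLIntegral_congr (Ioo_ae_eq_Icc (μ := volume) (a := (0 : ℝ)) (b := γ.len))]
  refine setLIntegral_mono' measurableSet_Ioo fun t ht => ?_
  obtain ⟨c, hc, hcg, hlip⟩ := h _ (hin t (Ioo_subset_Icc_self ht))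
  refine le_trans ?_ hcg
  rw [Real.enorm_eq_ofReal_abs]
  refine ENNReal.ofReal_le_ofReal (le_of_forall_pos_le_add fun ε hε => ?_)
  rw [← Real.norm_eq_abs]
  refine norm_deriv_le_of_lip' (by positivity) ?_
  have hnhds : Icc 0 γ.len ∈ 𝓝 t := Icc_mem_nhds ht.1 ht.2
  have hct : ContinuousAt γ.toFun t := hcont.continuousAt hnhds
  filter_upwards [hct.eventually (hlip ε hε), hnhds] with s hs hsI
  rw [Real.norm_eq_abs, Real.norm_eq_abs]
  refine hs.trans (mul_le_mul_of_nonneg_left ?_ (by positivity))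
  have := γ.lip.dist_le_mul s hsI t (Ioo_subset_Icc_self ht)
  simpa [Real.dist_eq] using this

/-- cutoff profile -/
noncomputable def psi (n : ℕ) (t s : ℝ) : ℝ := max 0 (min (((n : ℝ) + 1) * (t - s)) 1)

lemma psi_lip (n : ℕ) (t s s' : ℝ) : |psi n t s - psi n t s'| ≤ ((n : ℝ) + 1) * |s - s'| := by
  refine (clamp_lip 1 _ _).trans (le_of_eq ?_)
  rw [← mul_sub, abs_mul, abs_of_nonneg (by positivity), abs_sub_comm s s']
  congr 2; ring

lemma psi_nonneg (n : ℕ) (t s : ℝ) : 0 ≤ psi n t s := le_max_left _ _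
lemma psi_le_one (n : ℕ) (t s : ℝ) : psi n t s ≤ 1 := max_le zero_le_one (min_le_right _ _)

lemma psi_of_ge (n : ℕ) {t s : ℝ} (h : t ≤ s) : psi n t s = 0 := by
  unfold psi
  have : ((n : ℝ) + 1) * (t - s) ≤ 0 :=
    mul_nonpos_of_nonneg_of_nonpos (by positivity) (by linarith)
  exact max_eq_left ((min_le_left _ _).trans this)

lemma psi_of_le (n : ℕ) {t s : ℝ} (h : s ≤ t - 1 / ((n : ℝ) + 1)) : psi n t s = 1 := by
  unfold psi
  have hn : (0 : ℝ) < n + 1 := by positivity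
  have : 1 ≤ ((n : ℝ) + 1) * (t - s) := by
    have : 1 / ((n : ℝ) + 1) ≤ t - s := by linarith
    rw [div_le_iff₀ hn] at this
    linarith
  rw [min_eq_right this]; simp

lemma LocLipOn.continuousAt {X : Type*} [MetricSpace X] {v : X → ℝ} {Ω : Set X} (hΩ : IsOpen Ω) (hv : LocLipOn v Ω) {x : X}
    (hx : x ∈ Ω) : ContinuousAt v x := by
  obtain ⟨r, hr, K, hK⟩ := hv x hx
  exact hK.continuousOn.continuousAt (inter_mem (ball_mem_nhds x hr) (hΩ.mem_nhds hx))

section coarea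
variable {X : Type*} [MetricSpace X] [MeasurableSpace X]

lemma variation_le_liminf [BorelSpace X] {μ : Measure X} {Ω : Set X} (hΩ : IsOpen Ω)
    (hμΩ : μ Ω ≠ ⊤) {v : X → ℝ} (hvm : Measurable v) (hv : LocLipOn v Ω) {G : X → ℝ≥0∞}
    (hG : Measurable G)
    (h : ∀ x ∈ Ω, ∃ c, 0 ≤ c ∧ ENNReal.ofReal c ≤ G x ∧ LipAt v x c)
    {W : Set X} (hW : IsOpen W) (hWΩ : W ⊆ Ω) (t : ℝ) :
    variation μ (indicator {x ∈ Ω | v x < t} (fun _ => (1 : ℝ))) W ≤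
      liminf (fun n : ℕ => (Measure.map v (((μ.restrict Ω).withDensity G).restrict W))
        (Icc (t - 1 / ((n : ℝ) + 1)) t) / volume (Icc (t - 1 / ((n : ℝ) + 1)) t)) atTop := by
  have hlip : ∀ n, LocLipOn (fun x => psi n t (v x)) W := by
    intro n x hx
    obtain ⟨r, hr, K, hK⟩ := hv x (hWΩ hx)
    refine ⟨r, hr, (n + 1) * K, LipschitzOnWith.of_dist_le_mul fun y hy z hz => ?_⟩
    rw [Real.dist_eq]
    refine (psi_lip n t _ _).trans ?_
    have h1 := hK.dist_le_mul y ⟨hy.1, hWΩ hy.2⟩ z ⟨hz.1, hWΩ hz.2⟩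
    rw [Real.dist_eq] at h1
    push_cast
    rw [mul_assoc]
    exact mul_le_mul_of_nonneg_left h1 (by positivity)
  have hUm : MeasurableSet {x ∈ Ω | v x < t} :=
    hΩ.measurableSet.inter (measurableSet_lt hvm measurable_const)
  have hpm : ∀ n, Measurable fun x => psi n t (v x) := by
    intro n
    unfold psi
    fun_prop
  have hL1 : L1locTendsto μ (fun n x => psi n t (v x))
      (indicator {x ∈ Ω | v x < t} (fun _ => (1 : ℝ))) W := by
    intro K hK hKW
    have hKf : μ K ≠ ⊤ := ne_top_of_le_ne_top hμΩ (measure_mono (hKW.trans hWΩ))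
    have : Tendsto (fun n : ℕ => ∫⁻ x in K, ENNReal.ofReal |psi n t (v x) -
        indicator {x ∈ Ω | v x < t} (fun _ => (1 : ℝ)) x| ∂μ) atTop
        (𝓝 (∫⁻ x in K, (fun _ => 0) x ∂μ)) := by
      refine tendsto_lintegral_of_dominated_convergence (fun _ => 1) (fun n => ?_) (fun n => ?_)
        (by simpa using hKf) ?_
      · exact ENNReal.measurable_ofReal.comp
          (((hpm n).sub (measurable_const.indicator hUm)).abs)
      · refine Eventually.of_forall fun x => ?_
        rw [← ENNReal.ofReal_one]
        refine ENNReal.ofReal_le_ofReal ?_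
        have h0 := psi_nonneg n t (v x)
        have h1 := psi_le_one n t (v x)
        by_cases hx : x ∈ {x ∈ Ω | v x < t}
        · rw [indicator_of_mem hx, abs_le]; constructor <;> linarith
        · rw [indicator_of_notMem hx, abs_le]; constructor <;> linarith
      · refine (ae_restrict_iff' hK.measurableSet).2 (Eventually.of_forall fun x hx => ?_)
        refine tendsto_const_nhds.congr' ?_
        by_cases hxt : v x < t
        · have hx' : x ∈ {x ∈ Ω | v x < t} := ⟨hWΩ (hKW hx), hxt⟩
          have := (tendsto_one_div_add_atTop_nhds_zero_nat (𝕜 := ℝ)).eventually_lt_const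
            (show (0 : ℝ) < t - v x by linarith)
          filter_upwards [this] with n hn
          rw [indicator_of_mem hx', psi_of_le n (by linarith)]; simp
        · have hx' : x ∉ {x ∈ Ω | v x < t} := fun h => hxt h.2
          refine Eventually.of_forall fun n => ?_
          simp only [indicator_of_notMem hx', psi_of_ge n (not_lt.1 hxt)]; simp
    simpa using this
  unfold variation
  refine iInf_le_of_le (fun n x => psi n t (v x)) (iInf_le_of_le hlip (iInf_le_of_le hL1 ?_))
  refine liminf_le_liminf (Eventually.of_forall fun n => ?_)
  have hn : (0 : ℝ) < n + 1 := by positivity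
  set S : Set X := v ⁻¹' (Icc (t - 1 / ((n : ℝ) + 1)) t) with hS
  have hSm : MeasurableSet S := hvm measurableSet_Icc
  have hug : IsUpperGradientOn (fun x => psi n t (v x))
      (S.indicator fun x => ENNReal.ofReal ((n : ℝ) + 1) * G x) W := by
    refine upperGradient_of_lipAt (hlip n) fun x hx => ?_
    obtain ⟨c, hc, hcG, hcl⟩ := h x (hWΩ hx)
    by_cases hxS : x ∈ S
    · refine ⟨((n : ℝ) + 1) * c, by positivity, ?_, ?_⟩
      · rw [indicator_of_mem hxS, ENNReal.ofReal_mul hn.le]; gcongr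
      · intro ε hε
        filter_upwards [hcl (ε / (n + 1)) (by positivity)] with y hy
        refine (psi_lip n t _ _).trans ((mul_le_mul_of_nonneg_left hy hn.le).trans (le_of_eq ?_))
        field_simp
    · refine ⟨0, le_rfl, by simp, fun ε hε => ?_⟩
      have hcv := hv.continuousAt hΩ (hWΩ hx)
      have hev : ∀ᶠ y in 𝓝 x, psi n t (v y) = psi n t (v x) := by
        have hor : v x < t - 1 / ((n : ℝ) + 1) ∨ t < v x := by
          by_contra hcon
          push Not at hcon
          exact hxS ⟨hcon.1, hcon.2⟩
        rcases hor with h1 | h1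
        · filter_upwards [hcv.eventually_lt_const h1] with y hy
          rw [psi_of_le n hy.le, psi_of_le n h1.le]
        · filter_upwards [hcv.eventually_const_lt h1] with y hy
          rw [psi_of_ge n hy.le, psi_of_ge n h1.le]
      filter_upwards [hev] with y hy
      rw [hy, sub_self, abs_zero]; positivity
  refine iInf_le_of_le _ (iInf_le_of_le hug ?_)
  rw [Measure.map_apply hvm measurableSet_Icc, Measure.restrict_apply hSm,
    withDensity_apply _ (hSm.inter hW.measurableSet), Measure.restrict_restrict
      (hSm.inter hW.measurableSet), lintegral_indicator hSm, Measure.restrict_restrict hSm,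
    lintegral_const_mul _ hG, Real.volume_Icc]
  have e1 : S ∩ W ∩ Ω = S ∩ W := inter_eq_left.2 (inter_subset_right.trans hWΩ)
  have e2 : t - (t - 1 / ((n : ℝ) + 1)) = ((n : ℝ) + 1)⁻¹ := by rw [one_div]; ring
  rw [e1, e2, ENNReal.ofReal_inv_of_pos hn, ENNReal.div_eq_inv_mul, inv_inv]

lemma layer_partial (η g : ℝ≥0∞) (N : ℕ) :
    min g (N * η) ≤ ∑ k ∈ Finset.range N, (if (k : ℝ≥0∞) * η < g then η else 0) ∧
    ∑ k ∈ Finset.range N, (if (k : ℝ≥0∞) * η < g then η else 0) ≤ min (N * η) (g + η) := by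
  induction N with
  | zero => simp
  | succ N ih =>
    obtain ⟨h1, h2⟩ := ih
    rw [Finset.sum_range_succ]
    push_cast
    rw [add_mul, one_mul]
    split_ifs with h
    · refine ⟨?_, le_min (add_le_add_left (h2.trans (min_le_left _ _)) _) ?_⟩
      · calc min g (N * η + η) ≤ min g (N * η) + η := by
              rw [min_eq_right h.le]; exact min_le_right _ _
          _ ≤ _ := add_le_add_left h1 _
      · exact (add_le_add_left (h2.trans (min_le_left _ _)) _).trans (add_le_add_left h.le _)
    · rw [add_zero]
      rw [not_lt] at h
      rw [min_eq_left h] at h1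
      refine ⟨(min_le_left _ _).trans h1, h2.trans (min_le_min_right _ le_self_add)⟩

lemma layer_sum {η : ℝ≥0∞} (hη : η ≠ 0) (g : ℝ≥0∞) :
    g ≤ ∑' k : ℕ, (if (k : ℝ≥0∞) * η < g then η else 0) ∧
    ∑' k : ℕ, (if (k : ℝ≥0∞) * η < g then η else 0) ≤ g + η := by
  constructor
  · refine le_of_forall_lt fun b hb => ?_
    obtain ⟨b', hbb', hb'⟩ := exists_between hb
    refine hbb'.trans_le ?_
    obtain ⟨N, hN⟩ := ENNReal.exists_nat_mul_gt hη (ne_top_of_lt hb')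
    refine le_trans (le_min hb'.le hN.le) ((layer_partial η g N).1.trans ?_)
    exact ENNReal.sum_le_tsum _
  · rw [ENNReal.tsum_eq_iSup_nat]
    exact iSup_le fun N => (layer_partial η g N).2.trans (min_le_right _ _)

lemma perimeter_ae [BorelSpace X] {μ : Measure X} {Ω : Set X} (hΩ : IsOpen Ω)
    (hμΩ : μ Ω ≠ ⊤) {v : X → ℝ} (hvm : Measurable v) (hv : LocLipOn v Ω) {G : X → ℝ≥0∞}
    (hG : Measurable G) (hGi : ∫⁻ x in Ω, G x ∂μ ≠ ⊤)
    (h : ∀ x ∈ Ω, ∃ c, 0 ≤ c ∧ ENNReal.ofReal c ≤ G x ∧ LipAt v x c)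
    {W : Set X} (hW : IsOpen W) (hWΩ : W ⊆ Ω) :
    ∀ᵐ t : ℝ, variation μ (indicator {x ∈ Ω | v x < t} (fun _ => (1 : ℝ))) W ≤
      (Measure.map v (((μ.restrict Ω).withDensity G).restrict W)).rnDeriv volume t := by
  have := isFiniteMeasure_withDensity hGi
  filter_upwards [VitaliFamily.ae_tendsto_rnDeriv
    (IsUnifLocDoublingMeasure.vitaliFamily (volume : Measure ℝ) 1)
    (Measure.map v (((μ.restrict Ω).withDensity G).restrict W))] with t ht
  refine (variation_le_liminf hΩ hμΩ hvm hv hG h hW hWΩ t).trans (le_of_eq ?_)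
  refine Tendsto.liminf_eq ?_
  have h1 : Tendsto (fun n : ℕ => t - 1 / ((n : ℝ) + 1)) atTop (𝓝[<] t) := by
    refine tendsto_nhdsWithin_iff.2 ⟨?_, Eventually.of_forall fun n => ?_⟩
    · have := (tendsto_const_nhds (x := t)).sub
        (tendsto_one_div_add_atTop_nhds_zero_nat (𝕜 := ℝ))
      simpa using this
    · have : (0 : ℝ) < 1 / ((n : ℝ) + 1) := by positivity
      simpa using this
  exact ht.comp ((Real.tendsto_Icc_vitaliFamily_left t).comp h1)

lemma coarea_ineq [BorelSpace X] {μ : Measure X} {P : Set X → Measure X} (hP : IsPerimeter μ P)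
    {Ω E F : Set X} (hΩ : IsOpen Ω) (hEΩ : E ⊆ Ω) (hFΩ : F ⊆ Ω)
    (hμΩ : μ Ω ≠ ⊤) {v : X → ℝ} (hvm : Measurable v) (hv : LocLipOn v Ω) {G : X → ℝ≥0∞}
    (hG : Measurable G) (hGi : ∫⁻ x in Ω, G x ∂μ ≠ ⊤)
    (h : ∀ x ∈ Ω, ∃ c, 0 ≤ c ∧ ENNReal.ofReal c ≤ G x ∧ LipAt v x c)
    {a : ℝ} (hvE : ∀ x ∈ E, v x = 0) (hvF : ∀ x ∈ F, a ≤ v x) {f : X → ℝ≥0∞}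
    (hf : Admissible f (surfaceFamilyStar P E F Ω)) :
    ENNReal.ofReal a ≤ ∫⁻ x in Ω, f x * G x ∂μ := by
  set ν := (μ.restrict Ω).withDensity G with hν
  have hνf : IsFiniteMeasure ν := isFiniteMeasure_withDensity hGi
  have hI : ∫⁻ x in Ω, f x * G x ∂μ = ∫⁻ x, f x ∂ν := by
    rw [hν, lintegral_withDensity_eq_lintegral_mul _ hG hf.1]
    simp only [Pi.mul_apply, mul_comm]
  rw [hI]
  refine ENNReal.le_of_forall_pos_le_add fun ε hε _ => ?_
  set V := ν univ with hV
  have hVt : 1 + V ≠ ⊤ := ENNReal.add_ne_top.2 ⟨one_ne_top, measure_ne_top ν univ⟩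
  have hV0 : 1 + V ≠ 0 := by simp
  set η : ℝ≥0∞ := ε / (1 + V) with hη
  have hη0 : η ≠ 0 := ENNReal.div_ne_zero.2 ⟨by simpa using hε.ne', hVt⟩
  have hηV : η + η * V = ε := by
    have : η * (1 + V) = ε := ENNReal.div_mul_cancel hV0 hVt
    rwa [mul_add, mul_one] at this
  obtain ⟨g, hfg, hlsc, hgi⟩ := exists_le_lowerSemicontinuous_lintegral_ge ν f hf.1 hη0
  set W : ℕ → Set X := fun k => {x | (k : ℝ≥0∞) * η < g x} ∩ Ω with hW
  have hWo' : ∀ k : ℕ, IsOpen {x | (k : ℝ≥0∞) * η < g x} := fun k =>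
    hlsc.isOpen_preimage _
  have hWo : ∀ k, IsOpen (W k) := fun k => (hWo' k).inter hΩ
  have hWΩ : ∀ k, W k ⊆ Ω := fun k => inter_subset_right
  set D : ℕ → ℝ → ℝ≥0∞ := fun k =>
    (Measure.map v (ν.restrict (W k))).rnDeriv volume with hD
  have hae : ∀ᵐ t : ℝ, ∀ k, variation μ (indicator {x ∈ Ω | v x < t} (fun _ => (1 : ℝ))) (W k) ≤
      D k t := ae_all_iff.2 fun k => perimeter_ae hΩ hμΩ hvm hv hG hGi h (hWo k) (hWΩ k)
  have hlay : ∀ (m : Measure X), ∫⁻ x, ∑' k : ℕ, (if (k : ℝ≥0∞) * η < g x then η else 0) ∂m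
      = ∑' k : ℕ, η * m {x | (k : ℝ≥0∞) * η < g x} := by
    intro m
    rw [lintegral_tsum]
    · congr 1; funext k
      rw [← setLIntegral_const, ← lintegral_indicator (hWo' k).measurableSet]
      refine lintegral_congr fun x => ?_
      simp [indicator_apply]
    · intro k
      exact (Measurable.ite (hWo' k).measurableSet measurable_const measurable_const).aemeasurable
  have hone : ∀ᵐ t : ℝ, t ∈ Ioo 0 a → 1 ≤ ∑' k, η * D k t := by
    filter_upwards [hae] with t ht hta
    have hUo : IsOpen {x ∈ Ω | v x < t} := by
      rw [isOpen_iff_mem_nhds]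
      rintro x ⟨hx, hxt⟩
      filter_upwards [hΩ.mem_nhds hx, (hv.continuousAt hΩ hx).eventually_lt_const hxt] with y h1 h2
      exact ⟨h1, h2⟩
    have hmem : (P {x ∈ Ω | v x < t}).restrict Ω ∈ surfaceFamilyStar P E F Ω := by
      refine ⟨_, hUo.measurableSet, ?_, ?_, rfl⟩
      · rw [hUo.interior_eq]
        intro x hx
        exact ⟨hEΩ hx, by rw [hvE x hx]; exact hta.1⟩
      · intro x hx
        rw [mem_interior_iff_mem_nhds]
        filter_upwards [(hv.continuousAt hΩ (hFΩ hx)).eventually_const_lt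
          (hta.2.trans_le (hvF x hx))] with y hy hyU
        exact absurd hyU.2 (not_lt.2 hy.le)
    calc 1 ≤ ∫⁻ x, f x ∂((P {x ∈ Ω | v x < t}).restrict Ω) := hf.2 _ hmem
      _ ≤ ∫⁻ x, ∑' k : ℕ, (if (k : ℝ≥0∞) * η < g x then η else 0)
            ∂((P {x ∈ Ω | v x < t}).restrict Ω) :=
          lintegral_mono fun x => (hfg x).trans (layer_sum hη0 _).1
      _ = ∑' k : ℕ, η * P {x ∈ Ω | v x < t} (W k) := by
          rw [hlay]
          congr 1; funext k
          rw [Measure.restrict_apply (hWo' k).measurableSet]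
      _ ≤ _ := by
          refine ENNReal.tsum_le_tsum fun k => ?_
          gcongr
          rw [hP _ _ (hWo k)]
          exact ht k
  have hDm : ∀ k, Measurable (D k) := fun k => Measure.measurable_rnDeriv _ _
  calc ENNReal.ofReal a = ∫⁻ t in Ioo 0 a, 1 := by simp
    _ ≤ ∫⁻ t in Ioo 0 a, ∑' k, η * D k t :=
        lintegral_mono_ae ((ae_restrict_iff' measurableSet_Ioo).2 hone)
    _ ≤ ∫⁻ t, ∑' k, η * D k t := setLIntegral_le_lintegral _ _
    _ = ∑' k, η * ∫⁻ t, D k t := by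
        rw [lintegral_tsum fun k => ((hDm k).const_mul η).aemeasurable]
        congr 1; funext k
        rw [lintegral_const_mul _ (hDm k)]
    _ ≤ ∑' k : ℕ, η * ν {x | (k : ℝ≥0∞) * η < g x} := by
        refine ENNReal.tsum_le_tsum fun k => ?_
        gcongr
        refine Measure.lintegral_rnDeriv_le.trans ?_
        rw [Measure.map_apply hvm MeasurableSet.univ, preimage_univ,
          Measure.restrict_apply MeasurableSet.univ, univ_inter]
        exact measure_mono inter_subset_left
    _ = ∫⁻ x, ∑' k : ℕ, (if (k : ℝ≥0∞) * η < g x then η else 0) ∂ν := (hlay ν).symm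
    _ ≤ ∫⁻ x, (g x + η) ∂ν := lintegral_mono fun x => (layer_sum hη0 _).2
    _ = ∫⁻ x, g x ∂ν + η * V := by
        rw [lintegral_add_right _ measurable_const, lintegral_const]
    _ ≤ ∫⁻ x, f x ∂ν + η + η * V := by gcongr
    _ = ∫⁻ x, f x ∂ν + ε := by rw [add_assoc, hηV]

end coarea

/-- Cutoff functions of `e`. -/
noncomputable def cutC (k : ℕ) (s : ℝ) : ℝ :=
  if k = 0 then 1 else max 0 (min (2 - 2 ^ k * s) 1)

/-- Partition of unity on `{e > 0}`. -/
noncomputable def tau (k : ℕ) (s : ℝ) : ℝ := cutC k s - cutC (k + 1) s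

lemma cutC_nonneg (k : ℕ) (s : ℝ) : 0 ≤ cutC k s := by
  unfold cutC; split_ifs
  · exact zero_le_one
  · exact le_max_left _ _

lemma cutC_le_one (k : ℕ) (s : ℝ) : cutC k s ≤ 1 := by
  unfold cutC; split_ifs
  · exact le_rfl
  · exact max_le zero_le_one (min_le_right _ _)

lemma cutC_lip (k : ℕ) (s s' : ℝ) : |cutC k s - cutC k s'| ≤ 2 ^ k * |s - s'| := by
  unfold cutC; split_ifs with h
  · simp
  · refine (clamp_lip 1 _ _).trans (le_of_eq ?_)
    rw [show (2 : ℝ) - 2 ^ k * s - (2 - 2 ^ k * s') = 2 ^ k * (s' - s) by ring, abs_mul,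
      abs_of_nonneg (by positivity), abs_sub_comm]

lemma cutC_one {k : ℕ} {s : ℝ} (h : s ≤ (1 / 2) ^ k) : cutC k s = 1 := by
  unfold cutC; split_ifs
  · rfl
  · have h2 : (0 : ℝ) < 2 ^ k := by positivity
    have : (2 : ℝ) ^ k * s ≤ 1 := by
      rw [one_div, inv_pow] at h
      calc (2 : ℝ) ^ k * s ≤ 2 ^ k * (2 ^ k)⁻¹ := mul_le_mul_of_nonneg_left h h2.le
        _ = 1 := mul_inv_cancel₀ h2.ne'
    rw [min_eq_right (by linarith)]; simp

lemma cutC_zero {k : ℕ} {s : ℝ} (h : (1 / 2) ^ k ≤ s) : cutC (k + 1) s = 0 := by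
  unfold cutC
  rw [if_neg (by omega)]
  have h2 : (0 : ℝ) < 2 ^ k := by positivity
  have : 1 ≤ (2 : ℝ) ^ k * s := by
    rw [one_div, inv_pow] at h
    calc 1 = (2 : ℝ) ^ k * (2 ^ k)⁻¹ := (mul_inv_cancel₀ h2.ne').symm
      _ ≤ 2 ^ k * s := mul_le_mul_of_nonneg_left h h2.le
  rw [pow_succ]
  exact max_eq_left ((min_le_left _ _).trans (by linarith))

lemma tau_nonneg (k : ℕ) (s : ℝ) : 0 ≤ tau k s := by
  unfold tau
  rcases le_total s ((1 / 2) ^ k) with h | h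
  · rw [cutC_one h]; linarith [cutC_le_one (k + 1) s]
  · rw [cutC_zero h]; linarith [cutC_nonneg k s]

lemma tau_zero_of_le {k : ℕ} {s : ℝ} (h : s ≤ (1 / 2) ^ (k + 1)) : tau k s = 0 := by
  unfold tau
  have : ((1 : ℝ) / 2) ^ (k + 1) ≤ (1 / 2) ^ k := by
    rw [pow_succ]; have : (0 : ℝ) < (1 / 2) ^ k := by positivity
    linarith
  rw [cutC_one h, cutC_one (h.trans this), sub_self]

lemma tau_zero_of_ge {N k : ℕ} {s : ℝ} (h : (1 / 2) ^ N ≤ s) (hk : N < k) : tau k s = 0 := by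
  unfold tau
  have e1 : cutC k s = 0 := by
    obtain ⟨j, rfl⟩ : ∃ j, k = j + 1 := ⟨k - 1, by omega⟩
    refine cutC_zero (le_trans ?_ h)
    exact pow_le_pow_of_le_one (by norm_num) (by norm_num) (by omega)
  have e2 : cutC (k + 1) s = 0 := by
    refine cutC_zero (le_trans ?_ h)
    exact pow_le_pow_of_le_one (by norm_num) (by norm_num) (by omega)
  rw [e1, e2, sub_self]

lemma tau_lip (k : ℕ) (s s' : ℝ) : |tau k s - tau k s'| ≤ 2 ^ (k + 2) * |s - s'| := by
  have h1 := cutC_lip k s s'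
  have h2 := cutC_lip (k + 1) s s'
  unfold tau
  have h3 := abs_sub (cutC k s - cutC k s') (cutC (k + 1) s - cutC (k + 1) s')
  rw [show cutC k s - cutC (k + 1) s - (cutC k s' - cutC (k + 1) s') =
    cutC k s - cutC k s' - (cutC (k + 1) s - cutC (k + 1) s') by ring]
  have h4 : (0 : ℝ) ≤ 2 ^ k * |s - s'| := by positivity
  have h5 : (2 : ℝ) ^ (k + 1) * |s - s'| = 2 * (2 ^ k * |s - s'|) := by ring
  have h6 : (2 : ℝ) ^ (k + 2) * |s - s'| = 4 * (2 ^ k * |s - s'|) := by ring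
  linarith

lemma tau_sum (N : ℕ) {s : ℝ} (h : (1 / 2) ^ N ≤ s) :
    ∑ k ∈ Finset.range (N + 1), tau k s = 1 := by
  have h1 : ∑ k ∈ Finset.range (N + 1), tau k s = cutC 0 s - cutC (N + 1) s :=
    Finset.sum_range_sub' (fun k => cutC k s) (N + 1)
  rw [h1, cutC_zero h]; simp [cutC]

/-- Glued function. -/
noncomputable def glue {X : Type*} (e : X → ℝ) (w : ℕ → X → ℝ) (x : X) : ℝ :=
  ∑' k, tau k (e x) * w k x

section glue
variable {X : Type*}

lemma glue_eq {e : X → ℝ} (w : ℕ → X → ℝ) {N : ℕ} {x : X} (h : (1 / 2) ^ N ≤ e x) :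
    glue e w x = ∑ k ∈ Finset.range (N + 1), tau k (e x) * w k x := by
  refine tsum_eq_sum fun k hk => ?_
  rw [tau_zero_of_ge h (by simpa using hk), zero_mul]

lemma exists_half_pow {s : ℝ} (h : 0 < s) : ∃ N : ℕ, ((1 : ℝ) / 2) ^ N < s :=
  exists_pow_lt_of_lt_one h (by norm_num)

lemma glue_measurable [MeasurableSpace X] {e : X → ℝ} (he : Measurable e) {w : ℕ → X → ℝ}
    (hw : ∀ k, Measurable (w k)) : Measurable (glue e w) := by
  have htau : ∀ k, Measurable (tau k) := fun k =>
    (LipschitzWith.of_dist_le_mul (K := 2 ^ (k + 2)) fun s t => by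
      simpa [Real.dist_eq] using tau_lip k s t).continuous.measurable
  refine measurable_of_tendsto_metrizable
    (f := fun N x => ∑ k ∈ Finset.range (N + 1), tau k (e x) * w k x)
    (fun N => Finset.measurable_sum _ fun k _ => ((htau k).comp he).mul (hw k)) ?_
  rw [tendsto_pi_nhds]
  intro x
  refine tendsto_const_nhds.congr' ?_
  rcases le_or_gt (e x) 0 with h | h
  · refine Eventually.of_forall fun N => ?_
    have : ∀ k, tau k (e x) = 0 := fun k => tau_zero_of_le (h.trans (by positivity))
    simp [glue, this]
  · obtain ⟨N, hN⟩ := exists_half_pow h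
    filter_upwards [eventually_ge_atTop N] with M hM
    exact glue_eq w ((pow_le_pow_of_le_one (by norm_num) (by norm_num) hM).trans hN.le)

lemma glue_est [MetricSpace X] {e : X → ℝ} (he : ∀ x y, |e x - e y| ≤ dist x y)
    {φ : ℕ → X → ℝ} (hφm : ∀ x, Monotone fun m => φ m x)
    {n : ℕ → ℕ} {w : ℕ → X → ℝ}
    (hw : ∀ k y z, (1 / 2) ^ (k + 2) ≤ e y → (1 / 2) ^ (k + 2) ≤ e z →
      dist y z ≤ 1 / ((n k : ℝ) + 1) →
      |w k y - w k z| ≤ max (φ (n k) y) (φ (n k) z) * dist y z) {x : X} (hx : 0 < e x) :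
    ∃ r > 0, ∃ N m : ℕ, ∀ y ∈ ball x r, ∀ z ∈ ball x r, ∀ b : ℝ,
      |glue e w y - glue e w z| ≤ (max (φ m y) (φ m z) +
        ∑ k ∈ Finset.range N, 2 ^ (k + 2) * |w k z - b|) * dist y z := by
  obtain ⟨N, hN⟩ := exists_half_pow hx
  set m := ∑ k ∈ Finset.range (N + 1), n k with hm
  have hnm : ∀ k ∈ Finset.range (N + 1), n k ≤ m := fun k hk =>
    Finset.single_le_sum (f := n) (fun _ _ => Nat.zero_le _) hk
  set r := min (e x - (1 / 2) ^ N) (min ((1 / 2) ^ (N + 3)) (1 / (2 * ((m : ℝ) + 1)))) with hr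
  have hr0 : 0 < r := lt_min (by linarith) (lt_min (by positivity) (by positivity))
  have hr1 : r ≤ e x - (1 / 2) ^ N := min_le_left _ _
  have hr2 : r ≤ (1 / 2) ^ (N + 3) := (min_le_right _ _).trans (min_le_left _ _)
  have hr3 : r ≤ 1 / (2 * ((m : ℝ) + 1)) := (min_le_right _ _).trans (min_le_right _ _)
  have hin : ∀ y ∈ ball x r, (1 / 2) ^ N ≤ e y := by
    intro y hy
    have h1 := he x y
    rw [mem_ball, dist_comm] at hy
    have := le_abs_self (e x - e y)
    linarith
  refine ⟨r, hr0, N + 1, m, fun y hy z hz b => ?_⟩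
  have hyz : dist y z ≤ 2 * r := by
    have := dist_triangle_right y z x
    rw [mem_ball] at hy hz
    linarith
  rw [glue_eq w (hin y hy), glue_eq w (hin z hz), ← Finset.sum_sub_distrib]
  have hsy := tau_sum N (hin y hy)
  have hsz := tau_sum N (hin z hz)
  have hid : ∑ k ∈ Finset.range (N + 1), (tau k (e y) * w k y - tau k (e z) * w k z) =
      ∑ k ∈ Finset.range (N + 1), tau k (e y) * (w k y - w k z) +
      ∑ k ∈ Finset.range (N + 1), (tau k (e y) - tau k (e z)) * (w k z - b) := by
    have h0 : ∑ k ∈ Finset.range (N + 1), (tau k (e y) - tau k (e z)) * b = 0 := by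
      rw [← Finset.sum_mul, Finset.sum_sub_distrib, hsy, hsz]; ring
    rw [← add_zero (∑ k ∈ Finset.range (N + 1), (tau k (e y) * w k y - tau k (e z) * w k z)),
      ← neg_zero, ← h0, ← Finset.sum_add_distrib, ← Finset.sum_neg_distrib,
      ← Finset.sum_add_distrib]
    exact Finset.sum_congr rfl fun k _ => by ring
  rw [hid, add_mul]
  refine (abs_add_le _ _).trans (add_le_add ?_ ?_)
  · calc |∑ k ∈ Finset.range (N + 1), tau k (e y) * (w k y - w k z)|
        ≤ ∑ k ∈ Finset.range (N + 1), |tau k (e y) * (w k y - w k z)| :=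
          Finset.abs_sum_le_sum_abs _ _
      _ ≤ ∑ k ∈ Finset.range (N + 1), tau k (e y) * (max (φ m y) (φ m z) * dist y z) := by
          refine Finset.sum_le_sum fun k hk => ?_
          rw [abs_mul, abs_of_nonneg (tau_nonneg k _)]
          rcases le_or_gt (e y) ((1 / 2) ^ (k + 1)) with h | h
          · rw [tau_zero_of_le h]; simp
          · refine mul_le_mul_of_nonneg_left ?_ (tau_nonneg k _)
            have hkN : k ≤ N := by simpa [Nat.lt_succ_iff] using hk
            have a1 : ((1 : ℝ) / 2) ^ (N + 3) ≤ (1 / 2) ^ (k + 3) :=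
              pow_le_pow_of_le_one (by norm_num) (by norm_num) (by omega)
            have a2 : ((1 : ℝ) / 2) ^ (k + 3) = (1 / 2) ^ (k + 1) / 4 := by ring
            have a3 : ((1 : ℝ) / 2) ^ (k + 2) = (1 / 2) ^ (k + 1) / 2 := by ring
            have a4 : (0 : ℝ) < (1 / 2) ^ (k + 1) := by positivity
            have a5 := he y z
            have a6 := le_abs_self (e y - e z)
            refine (hw k y z (by linarith) (by linarith) ?_).trans ?_
            · have hnk : ((n k : ℕ) : ℝ) ≤ m := by exact_mod_cast hnm k hk
              calc dist y z ≤ 2 * r := hyz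
                _ ≤ 2 * (1 / (2 * ((m : ℝ) + 1))) := by linarith
                _ = 1 / ((m : ℝ) + 1) := by field_simp
                _ ≤ _ := by gcongr
            · exact mul_le_mul_of_nonneg_right
                (max_le_max (hφm y (hnm k hk)) (hφm z (hnm k hk))) dist_nonneg
      _ = _ := by rw [← Finset.sum_mul, hsy, one_mul]
  · rw [Finset.sum_mul]
    refine (Finset.abs_sum_le_sum_abs _ _).trans (Finset.sum_le_sum fun k _ => ?_)
    rw [abs_mul]
    have h1 := (tau_lip k (e y) (e z)).trans
      (mul_le_mul_of_nonneg_left (he y z) (by positivity))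
    calc |tau k (e y) - tau k (e z)| * |w k z - b| ≤ (2 ^ (k + 2) * dist y z) * |w k z - b| :=
          mul_le_mul_of_nonneg_right h1 (abs_nonneg _)
      _ = _ := by ring

lemma glue_loclip [MetricSpace X] {e : X → ℝ} (he : ∀ x y, |e x - e y| ≤ dist x y)
    {φ : ℕ → X → ℝ} (hφm : ∀ x, Monotone fun m => φ m x) {B : ℕ → ℝ} (hB : ∀ m x, φ m x ≤ B m)
    {n : ℕ → ℕ} {w : ℕ → X → ℝ} (hw1 : ∀ k x, |w k x| ≤ 1)
    (hw : ∀ k y z, (1 / 2) ^ (k + 2) ≤ e y → (1 / 2) ^ (k + 2) ≤ e z →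
      dist y z ≤ 1 / ((n k : ℝ) + 1) →
      |w k y - w k z| ≤ max (φ (n k) y) (φ (n k) z) * dist y z) :
    LocLipOn (glue e w) {x | 0 < e x} := by
  intro x hx
  obtain ⟨r, hr, N, m, hest⟩ := glue_est he hφm hw hx
  refine ⟨r, hr, Real.toNNReal (|B m| + ∑ k ∈ Finset.range N, 2 ^ (k + 2)),
    LipschitzOnWith.of_dist_le_mul fun y hy z hz => ?_⟩
  rw [Real.coe_toNNReal _ (by positivity), Real.dist_eq]
  refine (hest y hy.1 z hz.1 0).trans (mul_le_mul_of_nonneg_right (add_le_add ?_ ?_) dist_nonneg)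
  · exact max_le ((hB m y).trans (le_abs_self _)) ((hB m z).trans (le_abs_self _))
  · refine Finset.sum_le_sum fun k _ => ?_
    rw [sub_zero]
    have := hw1 k z
    have h2 : (0 : ℝ) < 2 ^ (k + 2) := by positivity
    nlinarith

lemma glue_lipAt [MetricSpace X] {e : X → ℝ} (he : ∀ x y, |e x - e y| ≤ dist x y)
    {φ : ℕ → X → ℝ} (hφm : ∀ x, Monotone fun m => φ m x) (hφc : ∀ m, Continuous (φ m))
    {n : ℕ → ℕ} {w : ℕ → X → ℝ}
    (hw : ∀ k y z, (1 / 2) ^ (k + 2) ≤ e y → (1 / 2) ^ (k + 2) ≤ e z →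
      dist y z ≤ 1 / ((n k : ℝ) + 1) →
      |w k y - w k z| ≤ max (φ (n k) y) (φ (n k) z) * dist y z) {x : X} (hx : 0 < e x) (b : ℝ) :
    ∃ N m : ℕ, LipAt (glue e w) x
      (φ m x + ∑ k ∈ Finset.range N, 2 ^ (k + 2) * |w k x - b|) := by
  obtain ⟨r, hr, N, m, hest⟩ := glue_est he hφm hw hx
  refine ⟨N, m, fun ε hε => ?_⟩
  filter_upwards [ball_mem_nhds x hr,
    (hφc m).continuousAt.eventually_lt_const (show φ m x < φ m x + ε by linarith)] with y hy hy2
  refine (hest y hy x (mem_ball_self hr) b).trans (mul_le_mul_of_nonneg_right ?_ dist_nonneg)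
  have : max (φ m y) (φ m x) ≤ φ m x + ε := max_le hy2.le (by linarith)
  linarith

end glue

/-- `L^p` norm of a nonnegative function. -/
noncomputable def NN {X : Type*} [MeasurableSpace X] (p : ℝ) (m : Measure X) (f : X → ℝ≥0∞) :
    ℝ≥0∞ := (∫⁻ x, f x ^ p ∂m) ^ (1 / p)

section lp
variable {X : Type*} [MeasurableSpace X] {m : Measure X} {p : ℝ}

lemma NN_mono (hp : 1 < p) {f g : X → ℝ≥0∞} (h : ∀ x, f x ≤ g x) : NN p m f ≤ NN p m g := by
  unfold NN
  have h1 : 0 ≤ 1 / p := by positivity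
  refine ENNReal.rpow_le_rpow (lintegral_mono fun x => ?_) h1
  exact ENNReal.rpow_le_rpow (h x) (by linarith)

lemma NN_add (hp : 1 < p) {f g : X → ℝ≥0∞} (hf : Measurable f) (hg : Measurable g) :
    NN p m (fun x => f x + g x) ≤ NN p m f + NN p m g :=
  ENNReal.lintegral_Lp_add_le hf.aemeasurable hg.aemeasurable hp.le

lemma NN_tsum (hp : 1 < p) {f : ℕ → X → ℝ≥0∞} (hf : ∀ k, Measurable (f k)) :
    NN p m (fun x => ∑' k, f k x) ≤ ∑' k, NN p m (f k) := by
  have hp0 : 0 < p := by linarith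
  have hpart : ∀ N, NN p m (fun x => ∑ k ∈ Finset.range N, f k x) ≤
      ∑ k ∈ Finset.range N, NN p m (f k) := by
    intro N
    induction N with
    | zero => simp [NN, hp0]
    | succ N ih =>
      simp_rw [Finset.sum_range_succ]
      refine (NN_add hp (Finset.measurable_sum _ fun k _ => hf k) (hf N)).trans ?_
      exact add_le_add_left ih _
  have hmono : Monotone fun (N : ℕ) x => (∑ k ∈ Finset.range N, f k x) ^ p := by
    intro N M hNM x
    exact ENNReal.rpow_le_rpow (Finset.sum_le_sum_of_subset (Finset.range_mono hNM)) hp0.le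
  have h1 : ∫⁻ x, (∑' k, f k x) ^ p ∂m = ⨆ N : ℕ, ∫⁻ x, (∑ k ∈ Finset.range N, f k x) ^ p ∂m := by
    rw [← lintegral_iSup (fun N => (Finset.measurable_sum _ fun k _ => hf k).pow_const p) hmono]
    refine lintegral_congr fun x => ?_
    rw [ENNReal.tsum_eq_iSup_nat]
    exact (ENNReal.orderIsoRpow p hp0).map_iSup _
  unfold NN
  rw [h1, show (⨆ N : ℕ, ∫⁻ x, (∑ k ∈ Finset.range N, f k x) ^ p ∂m) ^ (1 / p) =
    ⨆ N : ℕ, (∫⁻ x, (∑ k ∈ Finset.range N, f k x) ^ p ∂m) ^ (1 / p) from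
    (ENNReal.orderIsoRpow (1 / p) (by positivity)).map_iSup _]
  exact iSup_le fun N => (hpart N).trans (ENNReal.sum_le_tsum _)

lemma NN_const_indicator (hp : 1 < p) (c : ℝ≥0∞) {s : Set X} (hs : MeasurableSet s) :
    NN p m (s.indicator fun _ => c) = c * m s ^ (1 / p) := by
  have hp0 : 0 < p := by linarith
  unfold NN
  have : ∀ x, (s.indicator (fun _ => c) x) ^ p = s.indicator (fun _ => c ^ p) x := by
    intro x
    by_cases hx : x ∈ s <;> simp [hx, hp0]
  simp_rw [this]
  rw [lintegral_indicator hs, setLIntegral_const, ENNReal.mul_rpow_of_nonneg _ _ (by positivity),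
    ← ENNReal.rpow_mul, mul_one_div_cancel hp0.ne', ENNReal.rpow_one]

lemma tendsto_NN [IsFiniteMeasure m] (hp : 1 < p) {f : ℕ → X → ℝ} {g u : X → ℝ}
    (hf : ∀ n, Measurable (f n)) (hu : Measurable u)
    (hf1 : ∀ n x, f n x ∈ Icc (0 : ℝ) 1) (hu1 : ∀ x, u x ∈ Icc (0 : ℝ) 1)
    (hlim : ∀ x, Tendsto (fun n => f n x) atTop (𝓝 (g x))) {L : ℝ} (hL : 0 ≤ L) :
    Tendsto (fun n => NN p m (fun x => ENNReal.ofReal (L * |f n x - u x|))) atTop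
      (𝓝 (NN p m (fun x => ENNReal.ofReal (L * |g x - u x|)))) := by
  have hp0 : 0 < p := by linarith
  unfold NN
  refine (ENNReal.continuous_rpow_const.tendsto _).comp ?_
  refine tendsto_lintegral_of_dominated_convergence (fun _ => ENNReal.ofReal L ^ p)
    (fun n => ?_) (fun n => Eventually.of_forall fun x => ?_) ?_ (Eventually.of_forall fun x => ?_)
  · exact (ENNReal.measurable_ofReal.comp (((hf n).sub hu).abs.const_mul L)).pow_const p
  · refine ENNReal.rpow_le_rpow (ENNReal.ofReal_le_ofReal ?_) hp0.le
    have h1 : |f n x - u x| ≤ 1 := by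
      have a := hf1 n x
      have b := hu1 x
      rw [abs_le]; constructor <;> linarith [a.1, a.2, b.1, b.2]
    nlinarith
  · rw [lintegral_const]
    exact ENNReal.mul_ne_top (ENNReal.rpow_ne_top_of_nonneg hp0.le ENNReal.ofReal_ne_top)
      (measure_ne_top _ _)
  · refine (ENNReal.continuous_rpow_const.tendsto _).comp ?_
    exact (ENNReal.continuous_ofReal.tendsto _).comp (((hlim x).sub_const _).abs.const_mul L)

end lp

lemma exists_rho {X : Type*} [MetricSpace X] [MeasurableSpace X] [BorelSpace X] [CompleteSpace X]
    [SecondCountableTopology X] {m : Measure X} [IsFiniteMeasure m] {p : ℝ} (hp : 1 < p)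
    {ρ : X → ℝ≥0∞} (hρ : Measurable ρ) {E : Set X} (hE : IsCompact E) {ε : ℝ≥0∞} (hε : ε ≠ 0)
    (hεt : ε ≠ ⊤) :
    ∃ (ρ1 : X → ℝ≥0∞) (ε0 : ℝ) (K : ℕ → Set X), LowerSemicontinuous ρ1 ∧ (∀ x, ρ x ≤ ρ1 x) ∧
      0 < ε0 ∧ ε0 ≤ 1 ∧ (∀ x, ENNReal.ofReal ε0 ≤ ρ1 x) ∧ (∀ k, IsCompact (K k)) ∧
      (∀ k, E ⊆ K k) ∧ (∀ k, ∀ x ∉ K k, ENNReal.ofReal (2 ^ k) ≤ ρ1 x) ∧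
      NN p m ρ1 ≤ NN p m ρ + (ε + (ε + ε)) := by
  have hp0 : 0 < p := by linarith
  have hεp : ε ^ p ≠ 0 := by simp [hε, hεt, hp0]
  -- the lower semicontinuous majorant
  obtain ⟨g, hg1, hg2, hg3⟩ := exists_le_lowerSemicontinuous_lintegral_ge m
    (fun x => ρ x ^ p) (hρ.pow_const p) hεp
  have hcont : Continuous fun s : ℝ≥0∞ => s ^ (1 / p) := ENNReal.continuous_rpow_const
  have hmono : Monotone fun s : ℝ≥0∞ => s ^ (1 / p) :=
    ENNReal.monotone_rpow_of_nonneg (by positivity)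
  have hlsc0 : LowerSemicontinuous fun x => g x ^ (1 / p) :=
    hcont.comp_lowerSemicontinuous hg2 hmono
  have hle0 : ∀ x, ρ x ≤ g x ^ (1 / p) := by
    intro x
    have h1 := hmono (hg1 x)
    simp only [← ENNReal.rpow_mul, mul_one_div_cancel hp0.ne', ENNReal.rpow_one] at h1
    exact h1
  have hNN0 : NN p m (fun x => g x ^ (1 / p)) ≤ NN p m ρ + ε := by
    unfold NN
    simp only [← ENNReal.rpow_mul, one_div_mul_cancel hp0.ne', ENNReal.rpow_one]
    refine (hmono hg3).trans ?_
    refine (ENNReal.rpow_add_le_add_rpow _ _ (by positivity) ?_).trans ?_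
    · rw [div_le_one hp0]; exact hp.le
    · rw [← ENNReal.rpow_mul, mul_one_div_cancel hp0.ne', ENNReal.rpow_one]
  -- the constant
  obtain ⟨ε0, h01, h02, h03⟩ : ∃ ε0 : ℝ, 0 < ε0 ∧ ε0 ≤ 1 ∧
      ENNReal.ofReal ε0 * m univ ^ (1 / p) ≤ ε := by
    have hM : m univ ^ (1 / p) ≠ ⊤ :=
      ENNReal.rpow_ne_top_of_nonneg (by positivity) (measure_ne_top _ _)
    obtain ⟨δ, hδ, hδ2⟩ : ∃ δ : ℝ≥0, 0 < δ ∧ (δ : ℝ≥0∞) * m univ ^ (1 / p) < ε :=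
      ENNReal.exists_nnreal_pos_mul_lt hM hε
    refine ⟨min δ 1, lt_min (by exact_mod_cast hδ) one_pos, min_le_right _ _, ?_⟩
    refine le_trans ?_ hδ2.le
    gcongr
    rw [← ENNReal.ofReal_coe_nnreal]
    exact ENNReal.ofReal_le_ofReal (min_le_left _ _)
  -- the compact sets
  obtain ⟨e, he, hes⟩ := ENNReal.exists_pos_sum_of_countable' hε ℕ
  have hKex : ∀ k : ℕ, ∃ K : Set X, IsCompact K ∧ E ⊆ K ∧
      ENNReal.ofReal (2 ^ k) * m Kᶜ ^ (1 / p) ≤ e k := by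
    intro k
    have hδ : (e k / ENNReal.ofReal (2 ^ k)) ^ p ≠ 0 := by
      have h1 : e k / ENNReal.ofReal (2 ^ k) ≠ 0 := ENNReal.div_ne_zero.2
        ⟨(he k).ne', ENNReal.ofReal_ne_top⟩
      intro h
      rw [ENNReal.rpow_eq_zero_iff] at h
      rcases h with h | h
      · exact h1 h.1
      · linarith [h.2]
    obtain ⟨K, hK, hKm⟩ := exists_isCompact_closure_measure_compl_lt m _ (pos_iff_ne_zero.2 hδ)
    refine ⟨closure K ∪ E, hK.union hE, subset_union_right, ?_⟩
    have h1 : m (closure K ∪ E)ᶜ ≤ (e k / ENNReal.ofReal (2 ^ k)) ^ p :=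
      (measure_mono (compl_subset_compl.2 (subset_closure.trans subset_union_left))).trans hKm.le
    have h2 := hmono h1
    simp only [← ENNReal.rpow_mul, mul_one_div_cancel hp0.ne', ENNReal.rpow_one] at h2
    refine (mul_le_mul_right h2 _).trans ?_
    exact ENNReal.mul_div_le
  choose K hK1 hK2 hK3 using hKex
  have hlsci : ∀ k, LowerSemicontinuous ((K k)ᶜ.indicator fun _ => ENNReal.ofReal (2 ^ k)) :=
    fun k => (hK1 k).isClosed.isOpen_compl.lowerSemicontinuous_indicator zero_le
  have hlsc2 : LowerSemicontinuous fun x =>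
      ∑' k, (K k)ᶜ.indicator (fun _ => ENNReal.ofReal (2 ^ k)) x := lowerSemicontinuous_tsum hlsci
  refine ⟨fun x => g x ^ (1 / p) + (ENNReal.ofReal ε0 +
    ∑' k, (K k)ᶜ.indicator (fun _ => ENNReal.ofReal (2 ^ k)) x), ε0, K,
    hlsc0.add ((lowerSemicontinuous_const).add hlsc2),
    fun x => (hle0 x).trans le_self_add, h01, h02,
    fun x => le_self_add.trans le_add_self, hK1, hK2, ?_, ?_⟩
  · intro k x hx
    refine le_trans ?_ (le_add_self.trans le_add_self)
    refine le_trans ?_ (ENNReal.le_tsum k)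
    simp [hx]
  · refine (NN_add hp hlsc0.measurable (measurable_const.add hlsc2.measurable)).trans ?_
    refine (add_le_add hNN0 (NN_add hp measurable_const hlsc2.measurable)).trans ?_
    rw [add_assoc]
    refine add_le_add le_rfl (add_le_add le_rfl (add_le_add ?_ ?_))
    · have := NN_const_indicator (m := m) hp (ENNReal.ofReal ε0) MeasurableSet.univ
      rw [indicator_univ] at this
      rw [this]; exact h03
    · refine (NN_tsum hp fun k => (hlsci k).measurable).trans ?_
      refine le_trans (ENNReal.tsum_le_tsum fun k => ?_) hes.le
      rw [NN_const_indicator hp _ (hK1 k).isClosed.measurableSet.compl]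
      exact hK3 k

lemma exists_e {X : Type*} [MetricSpace X] {Ω : Set X} (hΩ : IsOpen Ω) :
    ∃ e : X → ℝ, (∀ x y, |e x - e y| ≤ dist x y) ∧ {x | 0 < e x} = Ω := by
  rcases eq_empty_or_nonempty Ωᶜ with h | h
  · refine ⟨fun _ => 1, fun x y => by simp, ?_⟩
    rw [compl_empty_iff] at h
    simp [h]
  · refine ⟨fun x => infDist x Ωᶜ, fun x y => ?_, ?_⟩
    · have := (lipschitz_infDist_pt Ωᶜ).dist_le_mul x y
      simpa [Real.dist_eq] using this
    · ext x
      have := hΩ.isClosed_compl.notMem_iff_infDist_pos h (x := x)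
      simpa using this.symm

lemma curve_aemeasurable {X : Type*} [MetricSpace X] [MeasurableSpace X] [BorelSpace X]
    [SecondCountableTopology X] (γ : Curve X) :
    AEMeasurable γ.toFun (volume.restrict (Icc 0 γ.len)) :=
  γ.lip.continuousOn.aemeasurable measurableSet_Icc

lemma one_le_lineIntegral {X : Type*} [MetricSpace X] [MeasurableSpace X] [BorelSpace X]
    [SecondCountableTopology X] {Γ : Set (Curve X)} {ρ : X → ℝ≥0∞}
    (hρ : Admissible ρ (Curve.toMeasure '' Γ)) {γ : Curve X} (hγ : γ ∈ Γ) :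
    1 ≤ γ.lineIntegral ρ := by
  have := hρ.2 _ ⟨γ, hγ, rfl⟩
  unfold Curve.toMeasure at this
  rwa [lintegral_map' hρ.1.aemeasurable (curve_aemeasurable γ)] at this

lemma dini {X : Type*} [MetricSpace X] [MeasurableSpace X] [BorelSpace X] [CompleteSpace X]
    [SecondCountableTopology X]
    {ρ ρ1 : X → ℝ≥0∞} (hρ : LowerSemicontinuous ρ1) (hle : ∀ x, ρ x ≤ ρ1 x)
    {ε0 : ℝ} (hε0 : 0 < ε0) (hε1 : ε0 ≤ 1)
    (hρε : ∀ x, ENNReal.ofReal ε0 ≤ ρ1 x) {E F A B Ω : Set X} (hE : IsClosed E) (hA : IsClosed A)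
    (hF : IsCompact F) (hB : IsOpen B) (hFB : F ⊆ B) (hBA : B ⊆ A) (hAΩ : A ⊆ Ω) (hEΩ : E ⊆ Ω)
    {K : ℕ → Set X} (hK : ∀ k, IsCompact (K k)) (hEK : ∀ k, E ⊆ K k)
    (hρK : ∀ k, ∀ x ∉ K k, ENNReal.ofReal (2 ^ k) ≤ ρ1 x)
    (hadm : Admissible ρ (Curve.toMeasure '' curveFamily E F Ω))
    {ε : ℝ} (hε : 0 < ε) :
    ∃ N : ℕ, ∀ n ≥ N, ∀ x ∈ F,
      1 - ε ≤ cdist E A (1 / ((n : ℝ) + 1)) (infConv ρ1 (n + 1)) x := by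
  have hmon : ∀ n m : ℕ, n ≤ m → ∀ x, cdist E A (1 / ((n : ℝ) + 1)) (infConv ρ1 (n + 1)) x ≤
      cdist E A (1 / ((m : ℝ) + 1)) (infConv ρ1 (m + 1)) x := by
    intro n m h x
    refine cdist_mono le_rfl ?_ (fun y => infConv_mono ρ1 (by omega) y) x
    have : (n : ℝ) ≤ m := by exact_mod_cast h
    gcongr
  refine hF.induction_on (p := fun s => ∃ N : ℕ, ∀ n ≥ N, ∀ x ∈ s,
      1 - ε ≤ cdist E A (1 / ((n : ℝ) + 1)) (infConv ρ1 (n + 1)) x) ⟨0, by simp⟩ ?_ ?_ ?_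
  · rintro s t hst ⟨N, hN⟩
    exact ⟨N, fun n hn x hx => hN n hn x (hst hx)⟩
  · rintro s t ⟨N, hN⟩ ⟨M, hM⟩
    refine ⟨max N M, fun n hn x hx => ?_⟩
    rcases hx with hx | hx
    · exact hN n (le_trans (le_max_left _ _) hn) x hx
    · exact hM n (le_trans (le_max_right _ _) hn) x hx
  · intro x hxF
    have hxA : x ∈ A := hBA (hFB hxF)
    obtain ⟨n, hn⟩ : ∃ n : ℕ, 1 - ε / 2 ≤
        cdist E A (1 / ((n : ℝ) + 1)) (infConv ρ1 (n + 1)) x := by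
      by_contra! hcon
      obtain ⟨γ, h0, h1, hin, hl⟩ := limit_curve hρ hε0 hε1 hρε hE hA hK hEK hρK
        (c := 1 - ε / 2) (x := x) (by linarith)
        (fun n => exists_path_of_cdist_lt (hcon n) (by linarith))
      have hγ : γ ∈ curveFamily E F Ω :=
        ⟨hin.trans hAΩ, Or.inl ⟨⟨h0, hEΩ h0⟩, by rw [h1]; exact ⟨hxF, hAΩ hxA⟩⟩⟩
      have h2 := one_le_lineIntegral hadm hγ
      have h3 : γ.lineIntegral ρ ≤ γ.lineIntegral ρ1 := lintegral_mono fun t => hle _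
      have h4 : ENNReal.ofReal (1 - ε / 2) < 1 := by
        rw [← ENNReal.ofReal_one]
        exact (ENNReal.ofReal_lt_ofReal_iff one_pos).2 (by linarith)
      exact absurd ((h2.trans h3).trans hl) (not_le.2 h4)
    set r : ℝ := min (1 / ((n : ℝ) + 1)) (ε / 2 / ((n : ℝ) + 1)) with hr
    have hr0 : 0 < r := by positivity
    refine ⟨ball x r ∩ B, mem_nhdsWithin_of_mem_nhds
      (inter_mem (ball_mem_nhds x hr0) (hB.mem_nhds (hFB hxF))), n, fun k hk y hy => ?_⟩
    refine le_trans ?_ (hmon n k hk y)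
    have hd : dist x y < r := by rw [dist_comm]; exact hy.1
    have h5 := cdist_abs_le (E := E) (infConv_nonneg ρ1 (n + 1)) hxA (hBA hy.2)
      (hd.le.trans (min_le_left _ _))
    have h6 : max (infConv ρ1 (n + 1) x) (infConv ρ1 (n + 1) y) ≤ (n : ℝ) + 1 :=
      max_le (by exact_mod_cast infConv_le_nat ρ1 (n + 1) x)
        (by exact_mod_cast infConv_le_nat ρ1 (n + 1) y)
    have h7 : max (infConv ρ1 (n + 1) x) (infConv ρ1 (n + 1) y) * dist x y ≤ ε / 2 := by
      calc _ ≤ ((n : ℝ) + 1) * (ε / 2 / ((n : ℝ) + 1)) :=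
            mul_le_mul h6 (hd.le.trans (min_le_right _ _)) dist_nonneg (by positivity)
        _ = ε / 2 := by field_simp
    have h8 := (abs_le.1 (h5.trans h7)).2
    linarith

set_option maxHeartbeats 1000000 in
lemma exists_good {X : Type*} [MetricSpace X] [MeasurableSpace X] [BorelSpace X] [CompleteSpace X]
    [SecondCountableTopology X] {μ : Measure X} {p : ℝ} (hp : 1 < p) {Ω E F : Set X}
    (hΩ : IsOpen Ω) (hμΩ : μ Ω < ⊤) (hEΩ : E ⊆ Ω) (hFΩ : F ⊆ Ω) (hE : IsCompact E)
    (hF : IsCompact F) (hEne : E.Nonempty) {ρ : X → ℝ≥0∞}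
    (hadm : Admissible ρ (Curve.toMeasure '' curveFamily E F Ω)) {ε : ℝ} (hε : 0 < ε) :
    ∃ (v : X → ℝ) (G : X → ℝ≥0∞), Measurable v ∧ LocLipOn v Ω ∧ Measurable G ∧
      (∀ x ∈ Ω, ∃ c, 0 ≤ c ∧ ENNReal.ofReal c ≤ G x ∧ LipAt v x c) ∧
      (∀ x ∈ E, v x = 0) ∧ (∀ x ∈ F, 1 - ε ≤ v x) ∧
      NN p (μ.restrict Ω) G ≤ NN p (μ.restrict Ω) ρ + 4 * ENNReal.ofReal ε := by
  have hp0 : 0 < p := by linarith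
  have : IsFiniteMeasure (μ.restrict Ω) := ⟨by simpa using hμΩ⟩
  set m := μ.restrict Ω with hm
  have hθ : ENNReal.ofReal ε ≠ 0 := by simpa using hε
  obtain ⟨ρ1, ε0, K, hlsc, hle, hε0, hε1, hρε, hK, hEK, hρK, hNN⟩ :=
    exists_rho (m := m) hp hadm.1 hE hθ ENNReal.ofReal_ne_top
  obtain ⟨e, he, hΩe⟩ := exists_e hΩ
  have hecont : Continuous e := (LipschitzWith.of_dist_le_mul (K := 1) fun x y => by
    simpa [Real.dist_eq] using he x y).continuous
  have hepos : ∀ x ∈ Ω, 0 < e x := by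
    intro x hx; rw [← hΩe] at hx; exact hx
  -- a uniform distance
  obtain ⟨j0, hj0⟩ : ∃ j0 : ℕ, ∀ x ∈ E ∪ F, ((1 : ℝ) / 2) ^ j0 < e x := by
    obtain ⟨x0, hx0, hmin⟩ := (hE.union hF).exists_isMinOn (hEne.mono subset_union_left)
      hecont.continuousOn
    obtain ⟨N, hN⟩ := exists_half_pow (hepos x0 (union_subset hEΩ hFΩ hx0))
    exact ⟨N, fun x hx => hN.trans_le (hmin hx)⟩
  have hpow : ∀ {i j : ℕ}, i ≤ j → ((1 : ℝ) / 2) ^ j ≤ (1 / 2) ^ i := fun h =>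
    pow_le_pow_of_le_one (by norm_num) (by norm_num) h
  set A : ℕ → Set X := fun j => {x | ((1 : ℝ) / 2) ^ j ≤ e x} with hAdef
  have hAc : ∀ j, IsClosed (A j) := fun j => isClosed_le continuous_const hecont
  have hAmono : ∀ i j, i ≤ j → A i ⊆ A j := fun i j h x hx => (hpow h).trans hx
  have hAΩ : ∀ j, A j ⊆ Ω := by
    intro j x hx
    rw [← hΩe]
    have h0 : (0 : ℝ) < (1 / 2) ^ j := by positivity
    exact lt_of_lt_of_le h0 hx
  set uu : ℕ → ℕ → X → ℝ := fun j n => cdist E (A j) (1 / ((n : ℝ) + 1)) (infConv ρ1 (n + 1))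
    with huu
  have uu0 : ∀ j n x, 0 ≤ uu j n x := fun j n x => cdist_nonneg _ _ _ _ _
  have uu1 : ∀ j n x, uu j n x ≤ 1 := fun j n x => cdist_le_one _ _ _ _ _
  have uumeas : ∀ j n, Measurable (uu j n) := fun j n =>
    cdist_measurable (hAc j) (by positivity) (infConv_nonneg ρ1 (n + 1))
      (infConv_le_nat ρ1 (n + 1))
  have uumono : ∀ j x, Monotone fun n => uu j n x := by
    intro j x n k h
    refine cdist_mono le_rfl ?_ (fun y => infConv_mono ρ1 (by omega) y) x
    have : (n : ℝ) ≤ k := by exact_mod_cast h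
    gcongr
  have uuanti : ∀ n x, Antitone fun j => uu j n x := by
    intro n x i j h
    exact cdist_mono (hAmono i j h) le_rfl (fun _ => le_rfl) x
  have uubdd : ∀ j x, BddAbove (range fun n => uu j n x) := fun j x =>
    ⟨1, by rintro _ ⟨n, rfl⟩; exact uu1 j n x⟩
  set ub : ℕ → X → ℝ := fun j x => ⨆ n, uu j n x with hub
  have ublim : ∀ j x, Tendsto (fun n => uu j n x) atTop (𝓝 (ub j x)) := fun j x =>
    tendsto_atTop_ciSup (uumono j x) (uubdd j x)
  have ub0 : ∀ j x, 0 ≤ ub j x := fun j x => Real.iSup_nonneg fun n => uu0 j n x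
  have ub1 : ∀ j x, ub j x ≤ 1 := fun j x => ciSup_le fun n => uu1 j n x
  have ubmeas : ∀ j, Measurable (ub j) := fun j =>
    measurable_of_tendsto_metrizable (uumeas j) (tendsto_pi_nhds.2 fun x => ublim j x)
  have ubanti : ∀ x, Antitone fun j => ub j x := by
    intro x i j h
    exact ciSup_mono (uubdd i x) fun n => uuanti n x h
  set u : X → ℝ := fun x => ⨅ j, ub j x with hu
  have ulim : ∀ x, Tendsto (fun j => ub j x) atTop (𝓝 (u x)) := fun x =>
    tendsto_atTop_ciInf (ubanti x) ⟨0, by rintro _ ⟨n, rfl⟩; exact ub0 n x⟩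
  have u0 : ∀ x, 0 ≤ u x := fun x => Real.iInf_nonneg fun j => ub0 j x
  have u1 : ∀ x, u x ≤ 1 := fun x =>
    le_of_tendsto (ulim x) (Eventually.of_forall fun j => ub1 j x)
  have umeas : Measurable u :=
    measurable_of_tendsto_metrizable ubmeas (tendsto_pi_nhds.2 fun x => ulim x)
  obtain ⟨e', he', hes⟩ := ENNReal.exists_pos_sum_of_countable' hθ ℕ
  -- choice of indices
  have hchoice : ∀ k : ℕ, ∃ j n : ℕ, k + 2 ≤ j ∧ j0 ≤ j ∧
      NN p m (fun x => ENNReal.ofReal (2 ^ (k + 2) * |uu j n x - u x|)) < e' k ∧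
      ∀ x ∈ F, 1 - ε ≤ uu j n x := by
    intro k
    have hL : (0 : ℝ) ≤ 2 ^ (k + 2) := by positivity
    have t1 := tendsto_NN (m := m) hp ubmeas umeas (fun j x => ⟨ub0 j x, ub1 j x⟩)
      (fun x => ⟨u0 x, u1 x⟩) ulim hL
    have z : NN p m (fun x => ENNReal.ofReal (2 ^ (k + 2) * |u x - u x|)) = 0 := by
      simp [NN, hp0]
    rw [z] at t1
    obtain ⟨j, hj1, hj2⟩ := ((t1.eventually_lt_const (he' k)).and
      (eventually_ge_atTop (max (k + 2) j0))).exists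
    have t2 := tendsto_NN (m := m) hp (uumeas j) umeas (fun n x => ⟨uu0 j n x, uu1 j n x⟩)
      (fun x => ⟨u0 x, u1 x⟩) (ublim j) hL
    have hj3 : j0 ≤ j := (le_max_right _ _).trans hj2
    obtain ⟨N, hN⟩ := dini (A := A j) (B := {x | ((1 : ℝ) / 2) ^ j < e x}) hlsc hle hε0 hε1 hρε
      hE.isClosed (hAc j) hF (isOpen_lt continuous_const hecont)
      (fun x hx => (hpow hj3).trans_lt (hj0 x (Or.inr hx)))
      (fun x (hx : ((1 : ℝ) / 2) ^ j < e x) => show ((1 : ℝ) / 2) ^ j ≤ e x from hx.le) (hAΩ j) hEΩ hK hEK hρK hadm hε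
    obtain ⟨n, hn1, hn2⟩ := ((t2.eventually_lt_const hj1).and (eventually_ge_atTop N)).exists
    exact ⟨j, n, (le_max_left _ _).trans hj2, hj3, hn1, hN n hn2⟩
  choose j n hjk hj0' hNNk hFk using hchoice
  set w : ℕ → X → ℝ := fun k => uu (j k) (n k) with hwdef
  set φ : ℕ → X → ℝ := fun i => infConv ρ1 (i + 1) with hφdef
  have hφm : ∀ x, Monotone fun i => φ i x := fun x a b h => infConv_mono ρ1 (by omega) x
  have hφc : ∀ i, Continuous (φ i) := fun i => infConv_continuous ρ1 (i + 1)
  have hw : ∀ k y z, (1 / 2) ^ (k + 2) ≤ e y → (1 / 2) ^ (k + 2) ≤ e z →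
      dist y z ≤ 1 / ((n k : ℝ) + 1) →
      |w k y - w k z| ≤ max (φ (n k) y) (φ (n k) z) * dist y z := by
    intro k y z hy hz hd
    exact cdist_abs_le (infConv_nonneg ρ1 (n k + 1)) ((hpow (hjk k)).trans hy)
      ((hpow (hjk k)).trans hz) hd
  have hSmeas : ∀ k, Measurable fun x => ENNReal.ofReal (2 ^ (k + 2) * |w k x - u x|) := fun k =>
    ENNReal.measurable_ofReal.comp
      (((uumeas (j k) (n k)).sub umeas).abs.const_mul ((2 : ℝ) ^ (k + 2)))
  have hSmeas' : Measurable fun x => ∑' k, ENNReal.ofReal (2 ^ (k + 2) * |w k x - u x|) :=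
    Measurable.tsum hSmeas
  refine ⟨glue e w, fun x => ρ1 x + ∑' k, ENNReal.ofReal (2 ^ (k + 2) * |w k x - u x|),
    glue_measurable hecont.measurable fun k => uumeas _ _, ?_, hlsc.measurable.add hSmeas',
    ?_, ?_, ?_, ?_⟩
  · rw [← hΩe]
    refine glue_loclip he hφm (B := fun i => ((i + 1 : ℕ) : ℝ))
      (fun i x => infConv_le_nat ρ1 (i + 1) x) (fun k x => ?_) hw
    rw [abs_of_nonneg (uu0 _ _ _)]; exact uu1 _ _ _
  · intro x hx
    obtain ⟨N, i, hlip⟩ := glue_lipAt he hφm hφc hw (hepos x hx) (u x)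
    refine ⟨_, ?_, ?_, hlip⟩
    · exact add_nonneg (infConv_nonneg ρ1 (i + 1) x)
        (Finset.sum_nonneg fun k _ => by positivity)
    · refine ENNReal.ofReal_add_le.trans (add_le_add (infConv_le ρ1 (i + 1) x) ?_)
      rw [ENNReal.ofReal_sum_of_nonneg fun k _ => by positivity]
      exact ENNReal.sum_le_tsum _
  · intro x hx
    unfold glue
    have : ∀ k, w k x = 0 := fun k => cdist_eq_zero
      (fun y hy => (hpow (hj0' k)).trans (hj0 y (Or.inl hy)).le) (by positivity) _ hx
    simp [this]
  · intro x hx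
    obtain ⟨N, hN⟩ := exists_half_pow (hepos x (hFΩ hx))
    rw [glue_eq w hN.le]
    calc 1 - ε = ∑ k ∈ Finset.range (N + 1), tau k (e x) * (1 - ε) := by
          rw [← Finset.sum_mul, tau_sum N hN.le, one_mul]
      _ ≤ _ := Finset.sum_le_sum fun k _ =>
          mul_le_mul_of_nonneg_left (hFk k x hx) (tau_nonneg _ _)
  · refine (NN_add hp hlsc.measurable hSmeas').trans ?_
    refine (add_le_add hNN ((NN_tsum hp hSmeas).trans
      ((ENNReal.tsum_le_tsum fun k => (hNNk k).le).trans hes.le))).trans ?_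
    apply le_of_eq
    ring

lemma secondCountable_of_balls {X : Type*} [MetricSpace X] [MeasurableSpace X] [BorelSpace X]
    {μ : Measure X} (h : ∀ (x : X) (r : ℝ), 0 < r → 0 < μ (ball x r) ∧ μ (ball x r) < ⊤)
    (x0 : X) : SecondCountableTopology X := by
  have : SigmaFinite μ := by
    refine ⟨⟨⟨fun n => ball x0 ((n : ℝ) + 1), fun _ => mem_univ _,
      fun n => (h x0 _ (by positivity)).2, ?_⟩⟩⟩
    rw [eq_univ_iff_forall]
    intro x
    obtain ⟨n, hn⟩ := exists_nat_gt (dist x x0)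
    exact mem_iUnion.2 ⟨n, by rw [mem_ball]; linarith⟩
  refine Metric.secondCountable_of_almost_dense_set fun ε hε => ?_
  obtain ⟨s, hs⟩ := zorn_subset {s : Set X | s.Pairwise fun x y => ε ≤ dist x y} (by
    intro c hc hchain
    refine ⟨⋃₀ c, ?_, fun s hs => subset_sUnion_of_mem hs⟩
    exact (pairwise_sUnion hchain.directedOn).2 fun a ha => hc ha)
  have hsp : s.Pairwise fun x y => ε ≤ dist x y := hs.prop
  refine ⟨s, ?_, fun x => ?_⟩
  · have hdis : Pairwise (Function.onFun Disjoint fun y : s => ball (y : X) (ε / 2)) := by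
      intro a b hab
      refine ball_disjoint_ball ?_
      have := hsp a.2 b.2 (fun h => hab (Subtype.ext h))
      linarith
    have hc := Measure.countable_meas_pos_of_disjoint_iUnion (μ := μ)
      (fun y : s => measurableSet_ball (x := (y : X)) (ε := ε / 2)) hdis
    have he : {i : s | 0 < μ (ball (i : X) (ε / 2))} = univ :=
      eq_univ_iff_forall.2 fun i => (h i _ (by positivity)).1
    rw [he] at hc
    exact countable_coe_iff.1 (countable_univ_iff.1 hc)
  · by_contra! hcon
    have h1 : insert x s ∈ {s : Set X | s.Pairwise fun x y => ε ≤ dist x y} := by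
      refine hsp.insert fun y hy _ => ⟨(hcon y hy).le, ?_⟩
      rw [dist_comm]; exact (hcon y hy).le
    have h2 := hs.le_of_ge h1 (subset_insert x s) (mem_insert x s)
    have := hcon x h2
    rw [dist_self] at this
    linarith

lemma modCurve_lt_top {X : Type*} [MetricSpace X] [MeasurableSpace X] [BorelSpace X]
    [SecondCountableTopology X] {μ : Measure X} {p : ℝ} (hp : 1 < p) {Ω E F : Set X}
    (hΩ : IsOpen Ω) (hμΩ : μ Ω < ⊤) (hE : IsCompact E) (hF : IsCompact F) (hEF : Disjoint E F) :
    ModCurve p μ (curveFamily E F Ω) < ⊤ := by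
  have hp0 : 0 < p := by linarith
  obtain ⟨δ, hδ, hdis⟩ := hEF.exists_thickenings hE hF.isClosed
  have hd : ∀ x ∈ E, ∀ y ∈ F, δ ≤ dist x y := by
    intro x hx y hy
    by_contra! hlt
    have hy1 : y ∈ thickening δ E := by
      rw [mem_thickening_iff]
      exact ⟨x, hx, by rwa [dist_comm]⟩
    exact Set.disjoint_left.1 hdis hy1 (self_subset_thickening hδ F hy)
  have hmeas : Measurable (Ω.indicator fun _ : X => ENNReal.ofReal (1 / δ)) :=
    measurable_const.indicator hΩ.measurableSet
  have hadm : Admissible (Ω.indicator fun _ => ENNReal.ofReal (1 / δ))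
      (Curve.toMeasure '' curveFamily E F Ω) := by
    refine ⟨hmeas, ?_⟩
    rintro _ ⟨γ, ⟨hin, hj⟩, rfl⟩
    unfold Curve.toMeasure
    rw [lintegral_map' hmeas.aemeasurable (curve_aemeasurable γ)]
    have h1 : ∫⁻ t in Icc (0 : ℝ) γ.len, Ω.indicator (fun _ => ENNReal.ofReal (1 / δ)) (γ.toFun t)
        = ∫⁻ t in Icc (0 : ℝ) γ.len, ENNReal.ofReal (1 / δ) := by
      refine setLIntegral_congr_fun measurableSet_Icc fun t ht => ?_
      exact indicator_of_mem (hin ⟨t, ht, rfl⟩) _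
    rw [h1, setLIntegral_const, Real.volume_Icc, sub_zero,
      ← ENNReal.ofReal_mul (by positivity), ← ENNReal.ofReal_one]
    refine ENNReal.ofReal_le_ofReal ?_
    have h2 : δ ≤ dist (γ.toFun 0) (γ.toFun γ.len) := by
      rcases hj with ⟨a, b⟩ | ⟨a, b⟩
      · exact hd _ a.1 _ b.1
      · rw [dist_comm]; exact hd _ b.1 _ a.1
    have h3 := γ.lip.dist_le_mul 0 ⟨le_rfl, γ.len_nonneg⟩ γ.len ⟨γ.len_nonneg, le_rfl⟩
    rw [Real.dist_eq, zero_sub, abs_neg, abs_of_nonneg γ.len_nonneg] at h3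
    have h4 : δ ≤ γ.len := by simpa using h2.trans h3
    rw [one_div_mul_eq_div, le_div_iff₀ hδ]
    linarith
  unfold ModCurve pMod
  refine lt_of_le_of_lt (iInf₂_le (Ω.indicator fun _ : X => ENNReal.ofReal (1 / δ)) hadm) ?_
  have : ∀ x, (Ω.indicator (fun _ => ENNReal.ofReal (1 / δ)) x) ^ p =
      Ω.indicator (fun _ => ENNReal.ofReal (1 / δ) ^ p) x := by
    intro x
    by_cases hx : x ∈ Ω <;> simp [hx, hp0]
  simp_rw [this]
  rw [lintegral_indicator hΩ.measurableSet, setLIntegral_const]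
  exact ENNReal.mul_lt_top (ENNReal.rpow_lt_top_of_nonneg hp0.le ENNReal.ofReal_ne_top) hμΩ

lemma NN_restrict_le {X : Type*} [MeasurableSpace X] {μ : Measure X} {p : ℝ} (hp : 1 < p)
    (Ω : Set X) (f : X → ℝ≥0∞) : NN p (μ.restrict Ω) f ≤ NN p μ f :=
  ENNReal.rpow_le_rpow (setLIntegral_le_lintegral _ _) (by positivity)

lemma core {X : Type*} [MetricSpace X] [MeasurableSpace X] [BorelSpace X] [CompleteSpace X]
    [SecondCountableTopology X] {μ : Measure X} {p q : ℝ} (hpq : p.HolderConjugate q)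
    {P : Set X → Measure X} (hP : IsPerimeter μ P) {Ω E F : Set X}
    (hΩ : IsOpen Ω) (hμΩ : μ Ω < ⊤) (hEΩ : E ⊆ Ω) (hFΩ : F ⊆ Ω) (hE : IsCompact E)
    (hF : IsCompact F) (hEne : E.Nonempty) {ρ f : X → ℝ≥0∞}
    (hadm : Admissible ρ (Curve.toMeasure '' curveFamily E F Ω))
    (hf : Admissible f (surfaceFamilyStar P E F Ω))
    (hρt : NN p μ ρ ≠ ⊤) (hft : NN q μ f ≠ ⊤) :
    1 ≤ NN q μ f * NN p μ ρ := by
  have hp := hpq.lt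
  have hq := hpq.symm.lt
  have key : ∀ ε : ℝ, 0 < ε →
      ENNReal.ofReal (1 - ε) ≤ NN q μ f * (NN p μ ρ + 4 * ENNReal.ofReal ε) := by
    intro ε hε
    obtain ⟨v, G, hvm, hvl, hG, hlip, hvE, hvF, hNN⟩ :=
      exists_good hp hΩ hμΩ hEΩ hFΩ hE hF hEne hadm hε
    have hNN' : NN p (μ.restrict Ω) G ≤ NN p μ ρ + 4 * ENNReal.ofReal ε :=
      hNN.trans (add_le_add (NN_restrict_le hp Ω ρ) le_rfl)
    have hGt : NN p (μ.restrict Ω) G ≠ ⊤ := ne_top_of_le_ne_top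
      (ENNReal.add_ne_top.2 ⟨hρt, ENNReal.mul_ne_top (by simp) ENNReal.ofReal_ne_top⟩) hNN'
    have hGi : ∫⁻ x in Ω, G x ∂μ ≠ ⊤ := by
      have h1 := ENNReal.lintegral_mul_le_Lp_mul_Lq (μ.restrict Ω) hpq hG.aemeasurable
        (g := fun _ => 1) aemeasurable_const
      simp only [Pi.mul_apply, mul_one, ENNReal.one_rpow, lintegral_const,
        Measure.restrict_apply MeasurableSet.univ, univ_inter, one_mul] at h1
      refine ne_top_of_le_ne_top (ENNReal.mul_ne_top hGt ?_) h1
      exact ENNReal.rpow_ne_top_of_nonneg (by positivity) hμΩ.ne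
    have h2 := coarea_ineq hP hΩ hEΩ hFΩ hμΩ.ne hvm hvl hG hGi hlip hvE hvF hf
    refine h2.trans ?_
    refine (ENNReal.lintegral_mul_le_Lp_mul_Lq (μ.restrict Ω) hpq.symm hf.1.aemeasurable
      hG.aemeasurable).trans ?_
    exact mul_le_mul' (NN_restrict_le hq Ω f) hNN'
  have hev : ∀ᶠ ε : ℝ in 𝓝[>] 0,
      ENNReal.ofReal (1 - ε) ≤ NN q μ f * (NN p μ ρ + 4 * ENNReal.ofReal ε) := by
    filter_upwards [self_mem_nhdsWithin] with ε hε using key ε hε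
  have l1 : Tendsto (fun ε : ℝ => ENNReal.ofReal (1 - ε)) (𝓝[>] 0) (𝓝 1) := by
    have : Continuous fun ε : ℝ => ENNReal.ofReal (1 - ε) :=
      ENNReal.continuous_ofReal.comp (continuous_const.sub continuous_id)
    simpa using (this.tendsto 0).mono_left nhdsWithin_le_nhds
  have l0 : Tendsto (fun ε : ℝ => 4 * ENNReal.ofReal ε) (𝓝[>] 0) (𝓝 0) := by
    have h := ENNReal.Tendsto.const_mul (a := 4)
      ((ENNReal.continuous_ofReal.tendsto 0).mono_left (nhdsWithin_le_nhds (s := Ioi 0)))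
      (Or.inr (by simp))
    simpa using h
  have l2 : Tendsto (fun ε : ℝ => NN q μ f * (NN p μ ρ + 4 * ENNReal.ofReal ε)) (𝓝[>] 0)
      (𝓝 (NN q μ f * NN p μ ρ)) := by
    refine ENNReal.Tendsto.const_mul ?_ (Or.inr hft)
    simpa using l0.const_add (NN p μ ρ)
  exact le_of_tendsto_of_tendsto l1 l2 hev

/-- Lower bound in the duality of moduli for compact `E, F`: for a nonempty bounded domain
`Ω` and disjoint nonempty compact sets `E, F ⊆ Ω`, if `Mod_{p/(p-1)}(𝓛*) < ∞` then
`1 ≤ Mod_{p/(p-1)}(𝓛*)^{(p-1)/p} Mod_p(Γ(E,F;Ω))^{1/p}`. -/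
theorem duality_lower_bound_compact {X : Type*} [MetricSpace X] [MeasurableSpace X]
    [BorelSpace X] [CompleteSpace X]
    (p : ℝ) (hp : 1 < p) (μ : Measure X) (Cd : ℝ≥0∞) (hCd : Doubling μ Cd)
    (CP lam : ℝ) (hPI : PoincareIneq μ 1 CP lam)
    (P : Set X → Measure X) (hP : IsPerimeter μ P)
    (Ω E F : Set X) (hΩo : IsOpen Ω) (hΩconn : IsConnected Ω) (hΩb : Bornology.IsBounded Ω)
    (hEΩ : E ⊆ Ω) (hFΩ : F ⊆ Ω) (hE : IsCompact E) (hF : IsCompact F)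
    (hEne : E.Nonempty) (hFne : F.Nonempty) (hEF : Disjoint E F)
    (hfin : pMod (p/(p-1)) μ (surfaceFamilyStar P E F Ω) < ⊤) :
    1 ≤ pMod (p/(p-1)) μ (surfaceFamilyStar P E F Ω) ^ ((p-1)/p) *
        ModCurve p μ (curveFamily E F Ω) ^ (1/p) := by

  obtain ⟨x0, hx0⟩ := hEne
  have hballs : ∀ (x : X) (r : ℝ), 0 < r → 0 < μ (ball x r) ∧ μ (ball x r) < ⊤ :=
    fun x r hr => ⟨(hCd x r hr).1, (hCd x r hr).2.2⟩
  have : SecondCountableTopology X := secondCountable_of_balls hballs x0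
  have hμΩ : μ Ω < ⊤ := by
    obtain ⟨r, hr⟩ := hΩb.subset_ball x0
    refine lt_of_le_of_lt (measure_mono (hr.trans (ball_subset_ball (le_max_left r 1)))) ?_
    exact (hballs x0 _ (lt_max_of_lt_right one_pos)).2
  have hpq : p.HolderConjugate (p / (p - 1)) := Real.HolderConjugate.conjExponent hp
  have hp0 : 0 < p := by linarith
  have hp1 : 0 < p - 1 := by linarith
  have hq0 : 0 < p / (p - 1) := div_pos hp0 hp1
  have hqi : (p - 1) / p = 1 / (p / (p - 1)) := by rw [one_div_div]
  have hB := modCurve_lt_top (μ := μ) hp hΩo hμΩ hE hF hEF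
  rw [hqi]
  set q := p / (p - 1) with hqdef
  set A := pMod q μ (surfaceFamilyStar P E F Ω) with hA
  set B := ModCurve p μ (curveFamily E F Ω) with hBdef
  have key : ∀ δ : ℝ, 0 < δ →
      1 ≤ (A + ENNReal.ofReal δ) ^ (1 / q) * (B + ENNReal.ofReal δ) ^ (1 / p) := by
    intro δ hδ
    have hδ' : ENNReal.ofReal δ ≠ 0 := by simpa using hδ
    have h1 : A < A + ENNReal.ofReal δ := ENNReal.lt_add_right hfin.ne hδ'
    have h2 : B < B + ENNReal.ofReal δ := ENNReal.lt_add_right hB.ne hδ'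
    rw [hA] at h1
    rw [hBdef] at h2
    unfold ModCurve at h2
    unfold pMod at h1 h2
    simp only [iInf_lt_iff] at h1 h2
    obtain ⟨f, hf, hfl⟩ := h1
    obtain ⟨ρ, hρ, hρl⟩ := h2
    have c := core hpq hP hΩo hμΩ hEΩ hFΩ hE hF ⟨x0, hx0⟩ hρ hf
      (ENNReal.rpow_ne_top_of_nonneg (by positivity) hρl.ne_top)
      (ENNReal.rpow_ne_top_of_nonneg (by positivity) hfl.ne_top)
    exact c.trans (mul_le_mul' (ENNReal.rpow_le_rpow hfl.le (by positivity))
      (ENNReal.rpow_le_rpow hρl.le (by positivity)))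
  have hlim : ∀ (C : ℝ≥0∞) (r : ℝ), Tendsto (fun δ : ℝ => (C + ENNReal.ofReal δ) ^ r) (𝓝[>] 0)
      (𝓝 (C ^ r)) := by
    intro C r
    refine (ENNReal.continuous_rpow_const.tendsto C).comp ?_
    have h := ((ENNReal.continuous_ofReal.tendsto 0).mono_left
      (nhdsWithin_le_nhds (s := Ioi 0))).const_add C
    simpa using h
  have hl := ENNReal.Tendsto.mul (hlim A (1 / q))
    (Or.inr (ENNReal.rpow_ne_top_of_nonneg (by positivity) hB.ne)) (hlim B (1 / p))
    (Or.inr (ENNReal.rpow_ne_top_of_nonneg (by positivity) hfin.ne))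
  refine ge_of_tendsto hl ?_
  filter_upwards [self_mem_nhdsWithin] with δ hδ using key δ hδ
end
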